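/- arXiv:2210.03193 — 2 statements merged into one kernel-verified Lean document; each statement's English description precedes it below -/
import Mathlib

section
/- Let A be an integral domain and let f : X → Spec(A) be a proper surjective morphism of schemes of finite presentation. If there exists a nonzero commutative A-algebra B such that the base change f_B : X ×_{Spec(A)} Spec(B) → Spec(B) is an M-morphism, then f itself is an M-morphism. -/
open AlgebraicGeometry CategoryTheory CategoryTheory.Limits

universe u

/-- The canonical map from `A` to the total ring of fractions of `A_red`. -/
noncomputable def totalFractionMap (A : Type u) [CommRing A] :
    CommRingCat.of A ⟶ CommRingCat.of (FractionRing (A ⧸ nilradical A)) :=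
  CommRingCat.ofHom ((algebraMap (A ⧸ nilradical A) (FractionRing (A ⧸ nilradical A))).comp
    (Ideal.Quotient.mk (nilradical A)))

/-- `f : X ⟶ Spec A` is an M-morphism if it is proper, of finite presentation, and its
base change to the total fraction ring of `A_red` is an isomorphism. -/
def IsMMorphism {A : Type u} [CommRing A] {X : Scheme.{u}}
    (f : X ⟶ Spec (CommRingCat.of A)) : Prop :=
  IsProper f ∧ LocallyOfFinitePresentation f ∧
    IsIso (pullback.snd f (Spec.map (totalFractionMap A)))

lemma isIso_snd_comp {X S T T' : Scheme.{u}} (f : X ⟶ S) (g : T ⟶ S) (g' : T' ⟶ T) :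
    IsIso (pullback.snd (pullback.snd f g) g') ↔ IsIso (pullback.snd f (g' ≫ g)) := by
  rw [← pullbackLeftPullbackSndIso_hom_snd f g g']
  exact isIso_comp_left_iff _ _

lemma isIso_snd_of {X S T : Scheme.{u}} (f : X ⟶ S) (g : T ⟶ S) {T' : Scheme.{u}} (g' : T' ⟶ T)
    (h : IsIso (pullback.snd f g)) : IsIso (pullback.snd f (g' ≫ g)) := by
  rw [← isIso_snd_comp]
  infer_instance

lemma isIso_snd_left {X X' S T : Scheme.{u}} (e : X' ⟶ X) [IsIso e] (f : X ⟶ S) (g : T ⟶ S)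
    (h : IsIso (pullback.snd f g)) : IsIso (pullback.snd (e ≫ f) g) := by
  have : pullback.snd (e ≫ f) g =
      pullback.map (e ≫ f) g f g e (𝟙 _) (𝟙 _) (by simp) (by simp) ≫ pullback.snd f g := by
    exact ((pullback.lift_snd _ _ _).trans (Category.comp_id _)).symm
  rw [this]
  infer_instance

lemma isFinite_of_top {X Y : Scheme.{u}} (f : X ⟶ Y) (h : IsFinite (f ∣_ ⊤)) : IsFinite f := by
  have i0 (Z : Scheme.{u}) : IsIso (⊤ : Z.Opens).ι := by
    rw [← Scheme.topIso_hom]; infer_instance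
  have i1 : IsIso (f ⁻¹ᵁ ⊤).ι := i0 X
  have i2 := i0 Y
  have e : f = inv (f ⁻¹ᵁ ⊤).ι ≫ f ∣_ ⊤ ≫ (⊤ : Y.Opens).ι := by
    rw [morphismRestrict_ι, IsIso.inv_hom_id_assoc]
  rw [e]
  infer_instance

lemma surjective_of_local {R C : Type u} [CommRing R] [IsLocalRing R] [CommRing C] [Algebra R C]
    [Module.Finite R C]
    (h : IsIso (pullback.snd (Spec.map (CommRingCat.ofHom (algebraMap R C)))
      (Spec.map (CommRingCat.ofHom (algebraMap R (IsLocalRing.ResidueField R)))))) :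
    Function.Surjective (algebraMap R C) := by
  have h2 : IsIso ((pullbackSpecIso R C (IsLocalRing.ResidueField R)).inv ≫ pullback.snd _ _) :=
    inferInstance
  rw [pullbackSpecIso_inv_snd, isIso_SpecMap_iff] at h2
  have h3 : (LinearMap.range (Algebra.linearMap R C)) = ⊤ := by
    rw [← IsLocalRing.map_tensorProduct_mk_eq_top, eq_top_iff]
    rintro x -
    obtain ⟨y, hy⟩ := h2.2 ((TensorProduct.comm _ _ _) x)
    obtain ⟨r, rfl⟩ := IsLocalRing.residue_surjective y
    refine ⟨algebraMap R C r, ⟨r, rfl⟩, (TensorProduct.comm _ _ _).injective ?_⟩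
    rw [← hy]
    simp only [TensorProduct.mk_apply, TensorProduct.comm_tmul]
    change _ = (1 : C) ⊗ₜ[R] (algebraMap R (IsLocalRing.ResidueField R) r)
    rw [Algebra.algebraMap_eq_smul_one, Algebra.algebraMap_eq_smul_one, TensorProduct.smul_tmul]
  intro c
  have : c ∈ (LinearMap.range (Algebra.linearMap R C)) := h3 ▸ trivial
  exact this

lemma isClosedImmersion_of_local {R : Type u} [CommRing R] [IsLocalRing R] {X : Scheme.{u}}
    (f : X ⟶ Spec (CommRingCat.of R)) [IsProper f]
    (h : IsIso (pullback.snd f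
      (Spec.map (CommRingCat.ofHom (algebraMap R (IsLocalRing.ResidueField R)))))) :
    IsClosedImmersion f := by
  have hfin : IsFinite f := by
    have key : (f ⁻¹' {IsLocalRing.closedPoint R}).Finite := by
      have hr := Scheme.Pullback.range_fst f
        (Spec.map (CommRingCat.ofHom (algebraMap R (IsLocalRing.ResidueField R))))
      have hs : ({IsLocalRing.closedPoint R} : Set (Spec (CommRingCat.of R))) ⊆ Set.range
        (Spec.map (CommRingCat.ofHom (algebraMap R (IsLocalRing.ResidueField R)))) := by
        rintro _ rfl
        refine ⟨IsLocalRing.closedPoint (IsLocalRing.ResidueField R), ?_⟩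
        exact IsLocalRing.comap_closedPoint (IsLocalRing.residue R)
      refine Set.Finite.subset ?_ (Set.preimage_mono hs)
      rw [← hr]
      have hfi : Finite (PrimeSpectrum (IsLocalRing.ResidueField R)) := inferInstance
      have : Finite ↥(pullback f
        (Spec.map (CommRingCat.ofHom (algebraMap R (IsLocalRing.ResidueField R))))) :=
        @Finite.of_injective _ _ hfi _ (pullback.snd f
          (Spec.map (CommRingCat.ofHom (algebraMap R (IsLocalRing.ResidueField R))))).homeomorph.injective
      exact Set.finite_range _
    obtain ⟨V, hV, hfV⟩ := exists_isFinite_morphismRestrict_of_finite_preimage_singleton f _ key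
    have hVt : V = ⊤ := by
      rw [eq_top_iff]
      intro x _
      exact (IsLocalRing.specializes_closedPoint x).mem_open V.isOpen hV
    subst hVt
    exact isFinite_of_top f hfV
  have : IsAffine X := isAffine_of_isAffineHom f
  obtain ⟨φ, hφ⟩ := Spec.map_surjective (X.isoSpec.inv ≫ f)
  have hφ2 : IsIso (pullback.snd (Spec.map φ)
      (Spec.map (CommRingCat.ofHom (algebraMap R (IsLocalRing.ResidueField R))))) := by
    rw [hφ]
    exact isIso_snd_left _ _ _ h
  have hφ3 : IsFinite (Spec.map φ) := by rw [hφ]; infer_instance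
  rw [IsFinite.SpecMap_iff] at hφ3
  algebraize [φ.hom]
  have hs := surjective_of_local (R := R) (C := Γ(X, ⊤)) hφ2
  have : IsClosedImmersion (X.isoSpec.inv ≫ f) := by
    rw [← hφ]; exact IsClosedImmersion.spec_of_surjective _ hs
  have : IsClosedImmersion (X.isoSpec.hom ≫ X.isoSpec.inv ≫ f) := inferInstance
  simpa using this

lemma isIso_snd_of_field {A K L : CommRingCat.{u}} {X : Scheme.{u}} (f : X ⟶ Spec A)
    (hK : IsField K) [Nontrivial L] (g : A ⟶ K) (g' : K ⟶ L)
    (h : IsIso (pullback.snd f (Spec.map (g ≫ g')))) : IsIso (pullback.snd f (Spec.map g)) := by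
  rw [Spec.map_comp, ← isIso_snd_comp] at h
  let := hK.toField
  have hff : g'.hom.FaithfullyFlat := by
    algebraize [g'.hom]
    change Module.FaithfullyFlat K L
    infer_instance
  obtain ⟨hfl, hsu⟩ := (flat_and_surjective_SpecMap_iff g').mpr hff
  refine MorphismProperty.of_pullback_snd_of_descendsAlong
    (P := MorphismProperty.isomorphisms Scheme) (Q := @Surjective ⊓ @Flat ⊓ @QuasiCompact)
    (g := Spec.map g') ?_ h
  exact ⟨⟨hsu, hfl⟩, inferInstance⟩

theorem stmt6 {A : Type u} [CommRing A] [IsDomain A] {X : Scheme.{u}}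
    (f : X ⟶ Spec (CommRingCat.of A))
    (hf₁ : IsProper f) (hf₂ : LocallyOfFinitePresentation f)
    (hf₃ : Function.Surjective f.base)
    (B : Type u) [CommRing B] [Nontrivial B] [Algebra A B]
    (hB : IsMMorphism (pullback.snd f (Spec.map (CommRingCat.ofHom (algebraMap A B))))) :
    IsMMorphism f := by
  refine ⟨hf₁, hf₂, ?_⟩
  have h1 := hB.2.2
  rw [isIso_snd_comp, ← Spec.map_comp] at h1
  set Q := FractionRing (B ⧸ nilradical B)
  have : Nontrivial (B ⧸ nilradical B) := by
    rw [Ideal.Quotient.nontrivial_iff, Ne, Ideal.eq_top_iff_one, mem_nilradical]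
    rintro ⟨n, hn⟩
    simp at hn
  have hQ : Nontrivial Q := inferInstance
  obtain ⟨m, hm⟩ := Ideal.exists_maximal Q
  have h2 := isIso_snd_of _ _ (Spec.map (CommRingCat.ofHom (Ideal.Quotient.mk m))) h1
  rw [← Spec.map_comp] at h2
  generalize hψ : (CommRingCat.ofHom (algebraMap A B) ≫ totalFractionMap B) ≫
    CommRingCat.ofHom (Ideal.Quotient.mk m) = ψ at h2
  let : Field (Q ⧸ m) := Ideal.Quotient.field m
  let p : Ideal A := RingHom.ker ψ.hom
  have hp : p.IsPrime := RingHom.ker_isPrime _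
  let R := Localization.AtPrime p
  let k := IsLocalRing.ResidueField R
  have hl0 : p.primeCompl ≤ (IsUnit.submonoid (Q ⧸ m)).comap ψ.hom := by
    intro x hx
    exact (isUnit_iff_ne_zero.mpr hx)
  let l : p.ResidueField →+* (Q ⧸ m) := Ideal.ResidueField.lift p ψ.hom le_rfl hl0
  have hl : ψ = CommRingCat.ofHom (algebraMap A p.ResidueField) ≫ CommRingCat.ofHom l := by
    ext x
    exact (Ideal.ResidueField.lift_algebraMap p ψ.hom le_rfl hl0 x).symm
  rw [hl] at h2
  have h3 := isIso_snd_of_field f (Field.toIsField p.ResidueField) _ _ h2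
  have h4 : CommRingCat.ofHom (algebraMap A p.ResidueField) =
    CommRingCat.ofHom (algebraMap A R) ≫ CommRingCat.ofHom (algebraMap R k) := by
    ext x
    exact IsScalarTower.algebraMap_apply A R k x
  rw [h4, Spec.map_comp, ← isIso_snd_comp] at h3
  have h5 := isClosedImmersion_of_local _ h3
  set t := totalFractionMap A with ht
  have hinj : Function.Injective t.hom := by
    refine (IsFractionRing.injective (A ⧸ nilradical A) _).comp ?_
    rw [RingHom.injective_iff_ker_eq_bot, Ideal.mk_ker, nilradical_eq_zero]
    rfl
  have : (nilradical A).IsPrime := by rw [nilradical_eq_zero]; exact Ideal.isPrime_bot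
  have hun : ∀ y : p.primeCompl, IsUnit (t.hom y) := by
    intro y
    rw [isUnit_iff_ne_zero]
    intro h0
    have : (y : A) = 0 := hinj (by simpa using h0)
    exact y.2 (this ▸ p.zero_mem)
  have ht2 : t = CommRingCat.ofHom (algebraMap A R) ≫
      CommRingCat.ofHom (IsLocalization.lift (M := p.primeCompl) (S := R) hun) := by
    ext x
    simp
  have hsurj : Surjective f := ⟨hf₃⟩
  have h6 : IsClosedImmersion (pullback.snd f (Spec.map t)) := by
    rw [ht2, Spec.map_comp, ← pullbackLeftPullbackSndIso_inv_snd_snd]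
    infer_instance
  exact isIso_of_isClosedImmersion_of_surjective _
end

section
/- Let (A_i)_{i∈I} be a direct system of integral domains over a directed index set I, with colimit A = colim_i A_i. Let f : X → Spec(A) be an M-morphism. Then there exists an index i ∈ I and an M-morphism f_i : X_i → Spec(A_i) whose base change along Spec(A) → Spec(A_i) is isomorphic to f as a scheme over Spec(A). -/
open AlgebraicGeometry CategoryTheory CategoryTheory.Limits

universe u

/-- codirected system of qcqs schemes with affine transition maps and a limit -/
structure ISys (I : Type u) [Preorder I] where
  X : I → Scheme.{u}
  map : ∀ {i j : I}, i ≤ j → (X i ⟶ X j)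
  map_id : ∀ i, map (le_refl i) = 𝟙 _
  map_comp : ∀ {i j k : I} (h : i ≤ j) (h' : j ≤ k), map h ≫ map h' = map (h.trans h')
  L : Scheme.{u}
  π : ∀ i, L ⟶ X i
  w : ∀ {i j : I} (h : i ≤ j), π i ≫ map h = π j
  lift : ∀ {T : Scheme.{u}} (a : ∀ i, T ⟶ X i) (_ : ∀ {i j : I} (h : i ≤ j), a i ≫ map h = a j),
    ∃ l : T ⟶ L, ∀ i, l ≫ π i = a i
  ext : ∀ {T : Scheme.{u}} (a b : T ⟶ L), (∀ i, a ≫ π i = b ≫ π i) → a = b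
  aff : ∀ {i j : I} (h : i ≤ j), IsAffineHom (map h)
  comp : ∀ i, CompactSpace (X i)
  qs : ∀ i, QuasiSeparatedSpace (X i)

namespace ISys

lemma w_assoc {I : Type u} [Preorder I] (Q : ISys I) {i j : I} (h : i ≤ j) {Z : Scheme.{u}} (x : Q.X j ⟶ Z) :
    Q.π i ≫ Q.map h ≫ x = Q.π j ≫ x := by rw [← Category.assoc, Q.w]

lemma map_comp_assoc {I : Type u} [Preorder I] (Q : ISys I) {i j k : I} (h : i ≤ j) (h' : j ≤ k)
    {Z : Scheme.{u}} (x : Q.X k ⟶ Z) :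
    Q.map h ≫ Q.map h' ≫ x = Q.map (h.trans h') ≫ x := by rw [← Category.assoc, Q.map_comp]

variable {I : Type u} [Preorder I] (Q : ISys I)

noncomputable section

/-- functor -/
def D : I ⥤ Scheme.{u} where
  obj := Q.X
  map f := Q.map (leOfHom f)
  map_id i := Q.map_id i
  map_comp f g := (Q.map_comp (leOfHom f) (leOfHom g)).symm

/-- cone -/
def c : Cone Q.D where
  pt := Q.L
  π := { app := Q.π
         naturality i j f := (Category.id_comp _).trans (Q.w (leOfHom f)).symm }

def hc : IsLimit Q.c where
  lift s := (Q.lift (T := s.pt) s.π.app (fun h => s.w (homOfLE h))).choose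
  fac s j := (Q.lift (T := s.pt) s.π.app (fun h => s.w (homOfLE h))).choose_spec j
  uniq s m hm := Q.ext _ _ (fun i => (hm i).trans
     ((Q.lift (T := s.pt) s.π.app (fun h => s.w (homOfLE h))).choose_spec i).symm)

instance {i j : I} (f : i ⟶ j) : IsAffineHom (Q.D.map f) := Q.aff _
instance (i : I) : CompactSpace (Q.D.obj i) := Q.comp _
instance (i : I) : QuasiSeparatedSpace (Q.D.obj i) := Q.qs _

/-- constant transformation -/
def t (i : I) (hi : ∀ j, j ≤ i) {S : Scheme.{u}} (s : Q.X i ⟶ S) :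
    Q.D ⟶ (Functor.const I).obj S where
  app j := Q.map (hi j) ≫ s
  naturality j k f := ((Category.assoc _ _ _).symm.trans
    (congrArg (· ≫ s) (Q.map_comp (leOfHom f) (hi k)))).trans (Category.comp_id _).symm

section
variable [IsCodirectedOrder I] [Nonempty I]

lemma exists_open (U : Q.L.Opens) (hU : IsCompact (U : Set Q.L)) :
    ∃ (i : I) (V : (Q.X i).Opens), IsCompact (V : Set (Q.X i)) ∧ Q.π i ⁻¹ᵁ V = U :=
  exists_preimage_eq Q.D Q.c Q.hc U hU

lemma aff_π (i : I) : IsAffineHom (Q.π i) := isAffineHom_π_app Q.D Q.c Q.hc i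

lemma top_eq (i : I) (hi : ∀ j, j ≤ i) {S Z : Scheme.{u}} (s : Q.X i ⟶ S) (f : Z ⟶ S)
    [LocallyOfFiniteType f] (a b : Q.X i ⟶ Z) (ha : a ≫ f = s) (hb : b ≫ f = s)
    (hab : Q.π i ≫ a = Q.π i ≫ b) : ∃ (k : I) (h : k ≤ i), Q.map h ≫ a = Q.map h ≫ b := by
  have h1 : (Q.t i hi s).app i = s := by
    refine (congrArg (· ≫ s) (Q.map_id i)).trans (Category.id_comp _)
  obtain ⟨k, h, e⟩ := Scheme.exists_hom_comp_eq_comp_of_locallyOfFiniteType Q.D (Q.t i hi s) f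
    Q.c Q.hc (i := i) a b (h1.trans ha.symm) (h1.trans hb.symm) hab
  exact ⟨k, leOfHom h, e⟩

lemma top_desc (i : I) (hi : ∀ j, j ≤ i) {S Z : Scheme.{u}} (s : Q.X i ⟶ S) (f : Z ⟶ S)
    [LocallyOfFinitePresentation f] (a : Q.L ⟶ Z) (ha : a ≫ f = Q.π i ≫ s) :
    ∃ (k : I) (b : Q.X k ⟶ Z), Q.π k ≫ b = a ∧ b ≫ f = Q.map (hi k) ≫ s := by
  obtain ⟨k, h, e, e'⟩ := Scheme.exists_π_app_comp_eq_of_locallyOfFinitePresentation Q.D (Q.t i hi s) f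
    Q.c Q.hc a (by
      apply NatTrans.ext
      funext j
      refine Eq.trans ?_ ha.symm
      exact Q.w_assoc (hi j) s)
  exact ⟨k, h, e, e'⟩

/-- restriction -/
def res (i : I) : ISys (Set.Iic i) where
  X j := Q.X j
  map h := Q.map h
  map_id j := Q.map_id _
  map_comp _ _ := Q.map_comp _ _
  L := Q.L
  π j := Q.π j
  w _ := Q.w _
  lift {T} a ha := by
    choose n hn1 hn2 using fun k : I => exists_le_le k i
    have key : ∀ (k : I) (p q : Set.Iic i) (hp : p.1 ≤ k) (hq : q.1 ≤ k),
        a p ≫ Q.map hp = a q ≫ Q.map hq := by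
      intro k p q hp hq
      obtain ⟨r, h1, h2⟩ := exists_le_le p.1 q.1
      let r' : Set.Iic i := ⟨r, h1.trans p.2⟩
      have e1 := ha (i := r') (j := p) h1
      have e2 := ha (i := r') (j := q) h2
      rw [← e1, ← e2, Category.assoc, Category.assoc, Q.map_comp, Q.map_comp]
    obtain ⟨l, hl⟩ := Q.lift (fun k => a ⟨n k, hn2 k⟩ ≫ Q.map (hn1 k)) (by
      intro k k' h
      rw [Category.assoc, Q.map_comp]
      exact key _ _ _ _ _)
    refine ⟨l, fun j => ?_⟩
    rw [hl]
    rw [key _ ⟨n j, hn2 j⟩ j (hn1 j) (le_refl _), Q.map_id, Category.comp_id]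
  ext {T} a b h := by
    apply Q.ext
    intro k
    obtain ⟨r, h1, h2⟩ := exists_le_le k i
    have := h ⟨r, h2⟩
    rw [← Q.w h1, reassoc_of% this]
  aff _ := Q.aff _
  comp _ := Q.comp _
  qs _ := Q.qs _

instance (i : I) : IsCodirectedOrder (Set.Iic i) where
  directed a b := by
    obtain ⟨r, h1, h2⟩ := exists_le_le a.1 b.1
    exact ⟨⟨r, h1.trans a.2⟩, h1, h2⟩

instance (i : I) : Nonempty (Set.Iic i) := ⟨⟨i, le_refl i⟩⟩

lemma hom_eq (i : I) {S Z : Scheme.{u}} (f : Z ⟶ S)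
    [LocallyOfFiniteType f] (a b : Q.X i ⟶ Z) (ha : a ≫ f = b ≫ f)
    (hab : Q.π i ≫ a = Q.π i ≫ b) : ∃ (k : I) (h : k ≤ i), Q.map h ≫ a = Q.map h ≫ b := by
  obtain ⟨k, h, e⟩ := (Q.res i).top_eq ⟨i, le_refl i⟩ (fun j => j.2) (a ≫ f) f a b rfl ha.symm hab
  exact ⟨k, h, e⟩

lemma hom_desc (i : I) {S Z : Scheme.{u}} (s : Q.X i ⟶ S) (f : Z ⟶ S)
    [LocallyOfFinitePresentation f] (a : Q.L ⟶ Z) (ha : a ≫ f = Q.π i ≫ s) :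
    ∃ (k : I) (h : k ≤ i) (b : Q.X k ⟶ Z), Q.π k ≫ b = a ∧ b ≫ f = Q.map h ≫ s := by
  obtain ⟨k, h, e⟩ := (Q.res i).top_desc ⟨i, le_refl i⟩ (fun j => j.2) s f a ha
  exact ⟨k, k.2, h, e⟩

/-- base change of the system along `g : Y ⟶ X i`, `i` being top, with prescribed pullbacks. -/
def bcTop (i : I) (hi : ∀ j, j ≤ i) {Y Y' : Scheme.{u}} (g : Y ⟶ Q.X i)
    (hqc : QuasiCompact g) (hqs : QuasiSeparated g)
    (y : Y' ⟶ Y) (p : Y' ⟶ Q.L) (H : IsPullback y p g (Q.π i))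
    (Z : I → Scheme.{u}) (z : ∀ j, Z j ⟶ Y) (q : ∀ j, Z j ⟶ Q.X j)
    (HZ : ∀ j, IsPullback (z j) (q j) g (Q.map (hi j))) : ISys I where
  X j := Z j
  map {j k} h := (HZ k).lift (z j) (q j ≫ Q.map h) (by
    rw [Category.assoc, Q.map_comp, (HZ j).w])
  map_id j := by
    apply (HZ j).hom_ext <;> simp [Q.map_id]
  map_comp {i j k} h h' := by
    apply (HZ k).hom_ext <;> simp [Q.map_comp]
  L := Y'
  π j := (HZ j).lift y (p ≫ Q.π j) (by rw [Category.assoc, Q.w, H.w])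
  w {i j} h := by
    apply (HZ j).hom_ext <;> simp [Q.w]
  lift {T} a ha := by
    obtain ⟨l, hl⟩ := Q.lift (fun j => a j ≫ q j) (by
      intro j k h
      rw [← ha h]
      simp)
    have h1 : ∀ j k, a j ≫ z j = a k ≫ z k := by
      have : ∀ {j k} (h : j ≤ k), a j ≫ z j = a k ≫ z k := by
        intro j k h
        rw [← ha h]
        simp
      intro j k
      rw [this (hi j), this (hi k)]
    refine ⟨H.lift (a i ≫ z i) l ?_, ?_⟩
    · rw [hl, Category.assoc, (HZ i).w, Q.map_id, Category.comp_id]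
    · intro j
      apply (HZ j).hom_ext
      · simp [h1 i j]
      · simp [hl]
  ext {T} a b h := by
    apply H.hom_ext
    · simpa using congrArg (· ≫ z i) (h i)
    · apply Q.ext
      intro j
      simpa using congrArg (· ≫ q j) (h j)
  aff {j k} h := by
    have := Q.aff h
    refine MorphismProperty.of_isPullback (P := @IsAffineHom) (f := q k)
      (f' := q j) (g := Q.map h) (IsPullback.flip ?_) this
    refine IsPullback.of_right (t := HZ k) ?_ (by simp) 
    rw [IsPullback.lift_fst, Q.map_comp]
    exact HZ j
  comp j := by
    have := Q.comp j
    have : QuasiCompact (q j) := MorphismProperty.of_isPullback (HZ j) hqc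
    exact QuasiCompact.compactSpace_of_compactSpace (q j)
  qs j := by
    have := Q.qs j
    have : QuasiSeparated (q j) := MorphismProperty.of_isPullback (HZ j) hqs
    exact quasiSeparatedSpace_of_quasiSeparated (q j)

/-- base change of the system along `g : Y ⟶ X i`. -/
def bc (i : I) {Y Y' : Scheme.{u}} (g : Y ⟶ Q.X i)
    (hqc : QuasiCompact g) (hqs : QuasiSeparated g)
    (y : Y' ⟶ Y) (p : Y' ⟶ Q.L) (H : IsPullback y p g (Q.π i)) : ISys (Set.Iic i) :=
  (Q.res i).bcTop ⟨i, le_refl i⟩ (fun j => j.2) g hqc hqs y p H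
    (fun j => pullback g (Q.map j.2)) (fun j => pullback.fst _ _) (fun j => pullback.snd _ _)
    (fun j => IsPullback.of_hasPullback _ _)

/-- The pullback as an opaque object with projections -/
structure BCData (i : I) {Y Y' : Scheme.{u}} (g : Y ⟶ Q.X i)
    (y : Y' ⟶ Y) (p : Y' ⟶ Q.L) where
  E : ISys (Set.Iic i)
  z : ∀ j, E.X j ⟶ Y
  q : ∀ j, E.X j ⟶ Q.X j.1
  e : Y' ≅ E.L
  sq : ∀ j : Set.Iic i, IsPullback (z j) (q j) g (Q.map (i := j.1) (j := i) j.2)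
  map_z : ∀ {j k} (h : j ≤ k), E.map h ≫ z k = z j
  map_q : ∀ {j k} (h : j ≤ k), E.map h ≫ q k = q j ≫ Q.map (i := j.1) (j := k.1) h
  π_z : ∀ j, e.hom ≫ E.π j ≫ z j = y
  π_q : ∀ j, e.hom ≫ E.π j ≫ q j = p ≫ Q.π j

def bcData (i : I) {Y Y' : Scheme.{u}} (g : Y ⟶ Q.X i)
    (hqc : QuasiCompact g) (hqs : QuasiSeparated g)
    (y : Y' ⟶ Y) (p : Y' ⟶ Q.L) (H : IsPullback y p g (Q.π i)) : Q.BCData i g y p where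
  E := Q.bc i g hqc hqs y p H
  z j := pullback.fst _ _
  q j := pullback.snd _ _
  e := Iso.refl Y'
  sq j := IsPullback.of_hasPullback _ _
  map_z h := IsPullback.lift_fst ..
  map_q h := IsPullback.lift_snd ..
  π_z j := (Category.id_comp _).trans (IsPullback.lift_fst ..)
  π_q j := (Category.id_comp _).trans (IsPullback.lift_snd ..)

variable {Q}
lemma BCData.map_z_assoc {i : I} {Y Y' : Scheme.{u}} {g : Y ⟶ Q.X i}
    {y : Y' ⟶ Y} {p : Y' ⟶ Q.L} (B : Q.BCData i g y p) {j k} (h : j ≤ k) {Z : Scheme.{u}} (x : Y ⟶ Z) :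
    B.E.map h ≫ B.z k ≫ x = B.z j ≫ x := by rw [← Category.assoc, B.map_z]

lemma BCData.map_q_assoc {i : I} {Y Y' : Scheme.{u}} {g : Y ⟶ Q.X i}
    {y : Y' ⟶ Y} {p : Y' ⟶ Q.L} (B : Q.BCData i g y p) {j k : Set.Iic i} (h : j ≤ k) {Z : Scheme.{u}}
    (x : Q.X k.1 ⟶ Z) :
    B.E.map h ≫ B.q k ≫ x = B.q j ≫ Q.map (i := j.1) (j := k.1) h ≫ x := by
  rw [← Category.assoc, B.map_q, Category.assoc]

lemma BCData.π_z_assoc {i : I} {Y Y' : Scheme.{u}} {g : Y ⟶ Q.X i}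
    {y : Y' ⟶ Y} {p : Y' ⟶ Q.L} (B : Q.BCData i g y p) (j : Set.Iic i) {Z : Scheme.{u}} (x : Y ⟶ Z) :
    B.e.hom ≫ B.E.π j ≫ B.z j ≫ x = y ≫ x := by
  have := congrArg (· ≫ x) (B.π_z j)
  simpa using this

lemma BCData.π_q_assoc {i : I} {Y Y' : Scheme.{u}} {g : Y ⟶ Q.X i}
    {y : Y' ⟶ Y} {p : Y' ⟶ Q.L} (B : Q.BCData i g y p) (j : Set.Iic i) {Z : Scheme.{u}}
    (x : Q.X j.1 ⟶ Z) :
    B.e.hom ≫ B.E.π j ≫ B.q j ≫ x = p ≫ Q.π j.1 ≫ x := by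
  have := congrArg (· ≫ x) (B.π_q j)
  simpa using this
end
end
end ISys

namespace ISys
variable {I : Type u} [Preorder I] (Q : ISys I) [IsCodirectedOrder I] [Nonempty I]

lemma iso_desc (i : I) {Y Y' : Scheme.{u}} (g : Y ⟶ Q.X i) [hqc : QuasiCompact g]
    [hqs : QuasiSeparated g] [LocallyOfFinitePresentation g]
    (y : Y' ⟶ Y) (p : Y' ⟶ Q.L) (H : IsPullback y p g (Q.π i)) (hp : IsIso p) :
    ∃ (k : I) (h : k ≤ i), ∀ {Z : Scheme.{u}} (z : Z ⟶ Y) (q : Z ⟶ Q.X k),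
      IsPullback z q g (Q.map h) → IsIso q := by
  have e1 : (inv p ≫ y) ≫ g = Q.π i ≫ 𝟙 _ := by
    rw [Category.assoc, H.w, IsIso.inv_hom_id_assoc, Category.comp_id]
  obtain ⟨k, h, b, hb1, hb2⟩ := Q.hom_desc i (𝟙 _) g (inv p ≫ y) e1
  rw [Category.comp_id] at hb2
  let B := Q.bcData i g hqc hqs y p H
  let k' : Set.Iic i := ⟨k, h⟩
  obtain ⟨l, hl, e⟩ := B.E.hom_eq k' g (B.z k') (B.q k' ≫ b) (by
    rw [Category.assoc, hb2, (B.sq k').w]) (by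
    rw [← cancel_epi B.e.hom, B.π_z, B.π_q_assoc, hb1, IsIso.hom_inv_id_assoc])
  rw [B.map_z, B.map_q_assoc] at e
  refine ⟨l, l.2, ?_⟩
  intro Z z q hZ
  have hl' : l.1 ≤ k := hl
  let s : Q.X l ⟶ Z := hZ.lift (Q.map hl' ≫ b) (𝟙 _) (by
    rw [Category.assoc, hb2, Q.map_comp, Category.id_comp])
  let φ : Z ⟶ B.E.X l := (B.sq l).lift z q hZ.w
  have hφ1 : φ ≫ B.z l = z := IsPullback.lift_fst ..
  have hφ2 : φ ≫ B.q l = q := IsPullback.lift_snd ..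
  have e3 : z = q ≫ Q.map hl' ≫ b := by
    rw [← hφ1, e, reassoc_of% hφ2]
  refine ⟨s, ?_, ?_⟩
  · apply hZ.hom_ext
    · rw [Category.assoc, IsPullback.lift_fst, Category.id_comp, ← e3]
    · rw [Category.assoc, IsPullback.lift_snd, Category.id_comp, Category.comp_id]
  · exact IsPullback.lift_snd ..

end ISys

lemma glue2 {V Y1 Y2 : Scheme.{u}} (a : V ⟶ Y1) (b : V ⟶ Y2) [IsOpenImmersion a] [IsOpenImmersion b] :
    ∃ (Y : Scheme.{u}) (i1 : Y1 ⟶ Y) (i2 : Y2 ⟶ Y), IsOpenImmersion i1 ∧ IsOpenImmersion i2 ∧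
      a ≫ i1 = b ≫ i2 ∧ (∀ y : Y, (∃ x, i1 x = y) ∨ (∃ x, i2 x = y)) ∧
      (∀ y1 y2, i1 y1 = i2 y2 → ∃ v, a v = y1 ∧ b v = y2) ∧
      (∀ {T : Scheme.{u}} (f1 : Y1 ⟶ T) (f2 : Y2 ⟶ T), a ≫ f1 = b ≫ f2 →
        ∃ f : Y ⟶ T, i1 ≫ f = f1 ∧ i2 ≫ f = f2) := by
  let F : WidePushoutShape WalkingPair ⥤ Scheme.{u} := span a b
  have hF : ∀ {i j} (f : i ⟶ j), IsOpenImmersion (F.map f) := by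
    intro i j f
    match i, j, f with
    | _, _, WidePushoutShape.Hom.id X => 
      have : F.map (WidePushoutShape.Hom.id X) = 𝟙 _ := F.map_id X
      rw [this]; infer_instance
    | _, _, WidePushoutShape.Hom.init .left => exact ‹IsOpenImmersion a›
    | _, _, WidePushoutShape.Hom.init .right => exact ‹IsOpenImmersion b›
  have o : ∀ i, IsOpenImmersion (colimit.ι F i) := fun i => inferInstance
  refine ⟨colimit F, colimit.ι F (some .left), colimit.ι F (some .right), o _, o _, ?_, ?_, ?_, ?_⟩
  · exact (colimit.w F (WidePushoutShape.Hom.init WalkingPair.left)).trans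
      (colimit.w F (WidePushoutShape.Hom.init WalkingPair.right)).symm
  · intro y
    obtain ⟨i, x, hx⟩ := Scheme.IsLocallyDirected.ι_jointly_surjective F y
    match i with
    | some .left => exact Or.inl ⟨x, hx⟩
    | some .right => exact Or.inr ⟨x, hx⟩
    | none =>
      left
      refine ⟨F.map (WidePushoutShape.Hom.init WalkingPair.left) x, ?_⟩
      rw [← hx]
      exact (Scheme.Hom.comp_apply (F.map (WidePushoutShape.Hom.init WalkingPair.left)) (colimit.ι F (some .left)) x).symm.trans
        (congrArg (fun m : F.obj none ⟶ colimit F => m x) (colimit.w F (WidePushoutShape.Hom.init WalkingPair.left)))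
  · intro y1 y2 h
    obtain ⟨k, f1, f2, x, h1, h2⟩ := (Scheme.IsLocallyDirected.ι_eq_ι_iff F).mp h
    match k, f1, f2 with
    | none, .init _, .init _ => exact ⟨x, h1, h2⟩
  · intro T f1 f2 h
    refine ⟨colimit.desc F (PushoutCocone.mk f1 f2 h), ?_, ?_⟩
    · exact colimit.ι_desc _ _
    · exact colimit.ι_desc _ _

/-- IsPullback can be checked on a two-piece open cover. -/
lemma isPullback_of_cover2 {Z Y L X Y1 Y2 Z1 Z2 : Scheme.{u}} (h : Z ⟶ Y) (p : Z ⟶ L) (g : Y ⟶ X) (l : L ⟶ X)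
    (hw : h ≫ g = p ≫ l) (i1 : Y1 ⟶ Y) (i2 : Y2 ⟶ Y) [IsOpenImmersion i1] [IsOpenImmersion i2]
    (hcov : ∀ y : Y, (∃ x, i1 x = y) ∨ (∃ x, i2 x = y))
    (z1 : Z1 ⟶ Z) (h1 : Z1 ⟶ Y1) (z2 : Z2 ⟶ Z) (h2 : Z2 ⟶ Y2)
    (H1 : IsPullback z1 h1 h i1) (H2 : IsPullback z2 h2 h i2)
    (K1 : IsPullback h1 (z1 ≫ p) (i1 ≫ g) l) (K2 : IsPullback h2 (z2 ≫ p) (i2 ≫ g) l) :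
    IsPullback h p g l := by
  let φ : Z ⟶ pullback g l := pullback.lift h p hw
  suffices IsIso φ by
    refine IsPullback.of_iso_pullback ⟨hw⟩ (asIso φ) ?_ ?_
    · exact pullback.lift_fst ..
    · exact pullback.lift_snd ..
  have key : ∀ {Y1 Z1 : Scheme.{u}} (i1 : Y1 ⟶ Y) (z1 : Z1 ⟶ Z) (h1 : Z1 ⟶ Y1)
    (H1 : IsPullback z1 h1 h i1) (K1 : IsPullback h1 (z1 ≫ p) (i1 ≫ g) l),
      ∃ (r : Z1 ⟶ pullback i1 (pullback.fst g l)), IsIso r ∧ 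
      IsPullback z1 r φ (pullback.snd i1 (pullback.fst g l)) := by
    intro Y1 Z1 i1 z1 h1 H1 K1
    have sq : IsPullback (pullback.fst i1 (pullback.fst g l)) (pullback.snd i1 (pullback.fst g l) ≫ pullback.snd g l)
        (i1 ≫ g) l :=
      (((IsPullback.of_hasPullback i1 (pullback.fst g l)).flip).paste_horiz
        (IsPullback.of_hasPullback g l).flip).flip
    let r := sq.lift h1 (z1 ≫ p) K1.w
    have hr1 : r ≫ pullback.fst i1 (pullback.fst g l) = h1 := IsPullback.lift_fst ..
    have hr2 : r ≫ pullback.snd i1 (pullback.fst g l) ≫ pullback.snd g l = z1 ≫ p := IsPullback.lift_snd ..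
    refine ⟨r, ?_, ?_⟩
    · have : r = (K1.isoIsPullback _ _ sq).hom := by
        apply sq.hom_ext <;> simp [r]
      rw [this]; infer_instance
    · have hc : z1 ≫ φ = r ≫ pullback.snd i1 (pullback.fst g l) := by
        apply pullback.hom_ext
        · rw [Category.assoc, Category.assoc, ← pullback.condition, reassoc_of% hr1,
            pullback.lift_fst, H1.w]
        · rw [Category.assoc, Category.assoc, hr2, pullback.lift_snd]
      refine (IsPullback.of_right (t := IsPullback.of_hasPullback i1 (pullback.fst g l)) ?_ hc.symm).flip
      rw [hr1, pullback.lift_fst]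
      exact H1.flip
  have key2 : ∀ {Y1 Z1 : Scheme.{u}} (i1 : Y1 ⟶ Y) [IsOpenImmersion i1] (z1 : Z1 ⟶ Z) (h1 : Z1 ⟶ Y1)
    (H1 : IsPullback z1 h1 h i1) (K1 : IsPullback h1 (z1 ≫ p) (i1 ≫ g) l) (x : ↥(pullback g l))
    (hx : ∃ t, i1 t = pullback.fst g l x), ∃ U : (pullback g l).Opens, x ∈ U ∧ 
      (MorphismProperty.isomorphisms Scheme) (φ ∣_ U) := by
    intro Y1 Z1 i1 _ z1 h1 H1 K1 x hx
    obtain ⟨r, hr, sq⟩ := key i1 z1 h1 H1 K1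
    let j := pullback.snd i1 (pullback.fst g l)
    refine ⟨j.opensRange, ?_, ?_⟩
    · change x ∈ Set.range j
      rw [IsOpenImmersion.range_pullbackSnd]
      exact hx
    · have e : j.isoOpensRange.inv ≫ j = j.opensRange.ι := Scheme.Hom.isoOpensRange_inv_comp j
      have s1 := (isPullback_morphismRestrict φ j.opensRange).flip
      rw [← e] at s1
      have s2 := IsPullback.of_right (h₁₁ := sq.lift (φ ⁻¹ᵁ j.opensRange).ι (φ ∣_ j.opensRange ≫ j.isoOpensRange.inv)
        (by rw [Category.assoc]; exact s1.w)) (t := sq) (v₁₁ := φ ∣_ j.opensRange)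
        (h₂₁ := j.isoOpensRange.inv) (by rw [IsPullback.lift_fst]; exact s1) (IsPullback.lift_snd ..)
      exact MorphismProperty.of_isPullback s2 hr
  change MorphismProperty.isomorphisms Scheme φ
  apply IsZariskiLocalAtTarget.of_forall_exists_morphismRestrict
  intro x
  rcases hcov (pullback.fst g l x) with hx | hx
  · exact key2 i1 z1 h1 H1 K1 x hx
  · exact key2 i2 z2 h2 H2 K2 x hx

lemma quasiSep_of_lft {X Y : Scheme.{u}} (f : X ⟶ Y) [IsLocallyNoetherian Y] [LocallyOfFiniteType f] :
    QuasiSeparated f := by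
  have : IsLocallyNoetherian X := LocallyOfFiniteType.isLocallyNoetherian f
  infer_instance

namespace ISys
variable {I : Type u} [Preorder I] (Q : ISys I) [IsCodirectedOrder I] [Nonempty I]

/-- limit map to a base change -/
lemma exists_lim {i k : I} (h : k ≤ i) {Y Z : Scheme.{u}} (g : Y ⟶ Q.X i) (y : Z ⟶ Y) (p : Z ⟶ Q.L)
    (H : IsPullback y p g (Q.π i)) {Y' : Scheme.{u}} (t : Y' ⟶ Y) (g' : Y' ⟶ Q.X k)
    (H' : IsPullback t g' g (Q.map h)) :
    ∃ y' : Z ⟶ Y', y' ≫ t = y ∧ IsPullback y' p g' (Q.π k) := by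
  refine ⟨H'.lift y (p ≫ Q.π k) (by rw [Category.assoc, Q.w, H.w]), IsPullback.lift_fst .., ?_⟩
  refine IsPullback.of_right (t := H') ?_ (IsPullback.lift_snd ..)
  rw [IsPullback.lift_fst, Q.w]
  exact H

lemma mor_desc (i : I) {V W T : Scheme.{u}} (g : V ⟶ Q.X i) [hqc : QuasiCompact g]
    [hqs : QuasiSeparated g] (w : W ⟶ V) (p : W ⟶ Q.L) (H : IsPullback w p g (Q.π i))
    (f : T ⟶ Q.X i) [LocallyOfFinitePresentation f] (a : W ⟶ T) (ha : a ≫ f = p ≫ Q.π i) :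
    ∃ (k : I) (h : k ≤ i), ∀ {V' : Scheme.{u}} (t : V' ⟶ V) (q : V' ⟶ Q.X k) (w' : W ⟶ V')
      (H' : IsPullback t q g (Q.map h)) (e1 : w' ≫ t = w) (e2 : w' ≫ q = p ≫ Q.π k),
      ∃ b : V' ⟶ T, w' ≫ b = a ∧ b ≫ f = t ≫ g := by
  let B := Q.bcData i g hqc hqs w p H
  let i' : Set.Iic i := ⟨i, le_refl i⟩
  obtain ⟨k, hk, b, hb1, hb2⟩ := B.E.hom_desc i' (B.z i' ≫ g) f (B.e.inv ≫ a) (by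
    rw [← cancel_epi B.e.hom, Category.assoc, Iso.hom_inv_id_assoc, ha, B.π_z_assoc, H.w])
  refine ⟨k, k.2, ?_⟩
  intro V' t q w' H' e1 e2
  have e3 : w' ≫ (B.sq k).lift t q H'.w = B.e.hom ≫ B.E.π k := by
    apply (B.sq k).hom_ext
    · rw [Category.assoc, Category.assoc, IsPullback.lift_fst, B.π_z, e1]
    · rw [Category.assoc, Category.assoc, IsPullback.lift_snd, B.π_q, e2]
  refine ⟨(B.sq k).lift t q H'.w ≫ b, ?_, ?_⟩
  · rw [reassoc_of% e3, hb1, Iso.hom_inv_id_assoc]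
  · rw [Category.assoc, hb2, B.map_z_assoc, IsPullback.lift_fst_assoc]

lemma iso_desc2 (i : I) [hN : IsLocallyNoetherian (Q.X i)] {V1 V2 W : Scheme.{u}} (g1 : V1 ⟶ Q.X i) (g2 : V2 ⟶ Q.X i)
    [QuasiCompact g1] [QuasiSeparated g1] [hqc : QuasiCompact g2] [hqs : QuasiSeparated g2]
    [LocallyOfFinitePresentation g1] [LocallyOfFinitePresentation g2]
    (w1 : W ⟶ V1) (w2 : W ⟶ V2) (p : W ⟶ Q.L)
    (H1 : IsPullback w1 p g1 (Q.π i)) (H2 : IsPullback w2 p g2 (Q.π i))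
    (φ : V1 ⟶ V2) (hφ : φ ≫ g2 = g1) (hw : w1 ≫ φ = w2) :
    ∃ (k : I) (h : k ≤ i), ∀ {V1' V2' : Scheme.{u}} (t1 : V1' ⟶ V1) (q1 : V1' ⟶ Q.X k)
      (t2 : V2' ⟶ V2) (q2 : V2' ⟶ Q.X k) (H1' : IsPullback t1 q1 g1 (Q.map h))
      (H2' : IsPullback t2 q2 g2 (Q.map h)) (φ' : V1' ⟶ V2') (e1 : φ' ≫ t2 = t1 ≫ φ)
      (e2 : φ' ≫ q2 = q1), IsIso φ' := by
  let B := Q.bcData i g2 hqc hqs w2 p H2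
  let i' : Set.Iic i := ⟨i, le_refl i⟩
  have hz : IsIso (B.z i') := by
    have := (B.sq i').flip
    rw [Q.map_id] at this
    exact (MorphismProperty.isomorphisms Scheme).of_isPullback this
      (inferInstanceAs (IsIso (𝟙 (Q.X i))))
  obtain ⟨ψ, hψ⟩ : ∃ ψ : V1 ⟶ B.E.X i', ψ ≫ B.z i' = φ := ⟨φ ≫ inv (B.z i'), by simp⟩
  have hψq : ψ ≫ B.q i' = g1 := by
    have := (B.sq i').w
    rw [Q.map_id, Category.comp_id] at this
    rw [← this, reassoc_of% hψ, hφ]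
  have lfφ : LocallyOfFinitePresentation φ := by
    have : IsLocallyNoetherian V2 := LocallyOfFiniteType.isLocallyNoetherian g2
    have : LocallyOfFiniteType (φ ≫ g2) := by rw [hφ]; infer_instance
    have := locallyOfFiniteType_of_comp φ g2
    exact LocallyOfFinitePresentation.iff_locallyOfFiniteType.mpr this
  have qcφ : QuasiCompact φ := by
    have : QuasiCompact (φ ≫ g2) := by rw [hφ]; infer_instance
    exact QuasiCompact.of_comp φ g2
  have qsφ : QuasiSeparated φ := by
    have : QuasiSeparated (φ ≫ g2) := by rw [hφ]; infer_instance
    exact QuasiSeparated.of_comp φ g2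
  have e0 : w1 ≫ ψ = B.e.hom ≫ B.E.π i' := by
    apply (B.sq i').hom_ext
    · rw [Category.assoc, Category.assoc, hψ, B.π_z, hw]
    · rw [Category.assoc, Category.assoc, hψq, B.π_q, H1.w]
  have sq : IsPullback w1 B.e.hom ψ (B.E.π i') := by
    have s2 : IsPullback (B.E.π i') (B.e.inv ≫ p) (B.q i') (Q.π i) := by
      have : IsPullback (B.E.π i' ≫ B.z i') (B.e.inv ≫ p) g2 (Q.π i) := by
        refine H2.of_iso B.e (Iso.refl _) (Iso.refl _) (Iso.refl _) ?_ ?_ ?_ ?_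
        · rw [B.π_z]; simp
        · simp
        · simp
        · simp
      refine this.of_iso (Iso.refl _) (asIso (B.z i')).symm (Iso.refl _) (Iso.refl _) ?_ ?_ ?_ ?_
      · simp
      · simp
      · have := (B.sq i').w
        rw [Q.map_id, Category.comp_id] at this
        simp [← this]
      · simp
    refine (IsPullback.of_right (h₁₂ := B.e.inv ≫ p) (v₁₂ := B.E.π i') (t := s2.flip) ?_ e0.symm).flip
    rw [hψq, Iso.hom_inv_id_assoc]
    exact H1.flip
  have lfψ : LocallyOfFinitePresentation ψ := by
    have : ψ = φ ≫ inv (B.z i') := by rw [← hψ]; simp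
    rw [this]; infer_instance
  have qcψ : QuasiCompact ψ := by
    have : ψ = φ ≫ inv (B.z i') := by rw [← hψ]; simp
    rw [this]; infer_instance
  have qsψ : QuasiSeparated ψ := by
    have : ψ = φ ≫ inv (B.z i') := by rw [← hψ]; simp
    rw [this]; infer_instance
  obtain ⟨k, hk, hiso⟩ := B.E.iso_desc i' ψ w1 B.e.hom sq inferInstance
  refine ⟨k, k.2, ?_⟩
  intro V1' V2' t1 q1 t2 q2 H1' H2' φ' e1 e2
  let r : V2' ⟶ B.E.X k := (B.sq k).lift t2 q2 H2'.w
  have hr1 : r ≫ B.z k = t2 := IsPullback.lift_fst ..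
  have hr2 : r ≫ B.q k = q2 := IsPullback.lift_snd ..
  have hr : IsIso r := by
    have : r = (H2'.isoIsPullback _ _ (B.sq k)).hom := by
      apply (B.sq k).hom_ext <;> simp [r]
    rw [this]; infer_instance
  have : IsIso (φ' ≫ r) := by
    apply hiso t1
    have s3 : IsPullback (B.E.map hk) (B.q k) (B.q i') (Q.map k.2) := by
      refine IsPullback.of_right (h₁₂ := B.z i') (t := B.sq i') ?_ (B.map_q hk)
      rw [B.map_z]
      have e := Q.map_comp (show k.1 ≤ i from k.2) (show i ≤ i from i'.2)
      exact e.symm ▸ B.sq k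
    refine (IsPullback.of_right (h₁₂ := B.q k) (t := s3.flip) ?_ ?_).flip
    · rw [hψq, Category.assoc, hr2, e2]
      exact H1'.flip
    · apply (B.sq i').hom_ext
      · rw [Category.assoc, Category.assoc, Category.assoc, B.map_z, hr1, e1, hψ]
      · rw [Category.assoc, Category.assoc, Category.assoc, B.map_q, reassoc_of% hr2, reassoc_of% e2,
          hψq, H1'.w]
  exact IsIso.of_isIso_comp_right φ' r

end ISys

/-- the two-element cover -/
noncomputable def cov2 {Z Z1 Z2 : Scheme.{u}} (s1 : Z1 ⟶ Z) (s2 : Z2 ⟶ Z) [h1 : IsOpenImmersion s1]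
    [h2 : IsOpenImmersion s2] (hcov : ∀ z : Z, (∃ x, s1 x = z) ∨ (∃ x, s2 x = z)) : Z.OpenCover :=
  Scheme.Cover.mkOfCovers Bool (fun b => Bool.rec Z1 Z2 b) (fun b => Bool.rec s1 s2 b)
    (fun x => by
      rcases hcov x with h | h
      · exact ⟨false, h⟩
      · exact ⟨true, h⟩)
    (fun b => by cases b <;> assumption)

lemma glue_mor {Z Z1 Z2 W T : Scheme.{u}} (s1 : Z1 ⟶ Z) (s2 : Z2 ⟶ Z) [IsOpenImmersion s1]
    [IsOpenImmersion s2] (hcov : ∀ z : Z, (∃ x, s1 x = z) ∨ (∃ x, s2 x = z))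
    (w1 : W ⟶ Z1) (w2 : W ⟶ Z2) (HW : IsPullback w1 w2 s1 s2)
    (a1 : Z1 ⟶ T) (a2 : Z2 ⟶ T) (ha : w1 ≫ a1 = w2 ≫ a2) :
    ∃ a : Z ⟶ T, s1 ≫ a = a1 ∧ s2 ≫ a = a2 := by
  have k1 : pullback.fst s1 s2 ≫ a1 = pullback.snd s1 s2 ≫ a2 := by
    rw [← cancel_epi HW.isoPullback.hom]; simpa using ha
  have k2 : pullback.fst s2 s1 ≫ a2 = pullback.snd s2 s1 ≫ a1 := by
    rw [← cancel_epi HW.flip.isoPullback.hom]; simpa using ha.symm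
  refine ⟨(cov2 s1 s2 hcov).glueMorphisms (fun b => Bool.rec a1 a2 b) ?_, ?_, ?_⟩
  · intro x y
    change Bool at x y
    rcases x with _ | _ <;> rcases y with _ | _
    · change pullback.fst s1 s1 ≫ a1 = pullback.snd s1 s1 ≫ a1
      have : pullback.fst s1 s1 = pullback.snd s1 s1 := by
        rw [← cancel_mono s1]; exact pullback.condition
      rw [this]
    · exact k1
    · exact k2
    · change pullback.fst s2 s2 ≫ a2 = pullback.snd s2 s2 ≫ a2
      have : pullback.fst s2 s2 = pullback.snd s2 s2 := by
        rw [← cancel_mono s2]; exact pullback.condition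
      rw [this]
  · exact (cov2 s1 s2 hcov).ι_glueMorphisms _ _ false
  · exact (cov2 s1 s2 hcov).ι_glueMorphisms _ _ true

lemma hom_ext2 {Z Z1 Z2 T : Scheme.{u}} (s1 : Z1 ⟶ Z) (s2 : Z2 ⟶ Z) [IsOpenImmersion s1]
    [IsOpenImmersion s2] (hcov : ∀ z : Z, (∃ x, s1 x = z) ∨ (∃ x, s2 x = z))
    (a b : Z ⟶ T) (h1 : s1 ≫ a = s1 ≫ b) (h2 : s2 ≫ a = s2 ≫ b) : a = b := by
  apply (cov2 s1 s2 hcov).hom_ext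
  intro x
  change Bool at x
  rcases x with _ | _
  · exact h1
  · exact h2

namespace ISys
variable {I : Type u} [Preorder I] (Q : ISys I) 

/-- descended open immersion -/
structure Pair (i : I) {Z W : Scheme.{u}} (p : Z ⟶ Q.L) (w : W ⟶ Z) where
  Y : Scheme.{u}
  V : Scheme.{u}
  g : Y ⟶ Q.X i
  v : V ⟶ Y
  y : Z ⟶ Y
  w' : W ⟶ V
  lfp : LocallyOfFinitePresentation g
  qc : QuasiCompact g
  oi : IsOpenImmersion v
  qcV : QuasiCompact (v ≫ g)
  H : IsPullback y p g (Q.π i)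
  HV : IsPullback w' w v y

lemma Pair.hw {Q : ISys I} {i : I} {Z W : Scheme.{u}} {p : Z ⟶ Q.L} {w : W ⟶ Z} (P : Q.Pair i p w) :
    IsPullback P.w' (w ≫ p) (P.v ≫ P.g) (Q.π i) := 
  (P.HV.flip.paste_horiz P.H.flip).flip

lemma Pair.mono [IsCodirectedOrder I] [Nonempty I] {Q : ISys I} {i k : I} (h : k ≤ i) {Z W : Scheme.{u}} {p : Z ⟶ Q.L} {w : W ⟶ Z} (P : Q.Pair i p w) :
    ∃ (P' : Q.Pair k p w) (s : P'.V ⟶ P.V), IsPullback s (P'.v ≫ P'.g) (P.v ≫ P.g) (Q.map h) ∧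
      P'.w' ≫ s = P.w' := by
  have := P.lfp
  have := P.qc
  have := P.oi
  have := P.qcV
  obtain ⟨Y', t, g', H'⟩ : ∃ (Y' : Scheme.{u}) (t : Y' ⟶ P.Y) (g' : Y' ⟶ Q.X k), IsPullback t g' P.g (Q.map h) :=
    ⟨_, _, _, IsPullback.of_hasPullback _ _⟩
  obtain ⟨y', hy', H2⟩ := Q.exists_lim h P.g P.y p P.H t g' H'
  obtain ⟨V', s, v', HV'⟩ : ∃ (V' : Scheme.{u}) (s : V' ⟶ P.V) (v' : V' ⟶ Y'), IsPullback s v' P.v t :=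
    ⟨_, _, _, IsPullback.of_hasPullback _ _⟩
  have sq : IsPullback s (v' ≫ g') (P.v ≫ P.g) (Q.map h) := (HV'.flip.paste_horiz H'.flip).flip
  refine ⟨⟨Y', V', g', v', y', HV'.lift P.w' (w ≫ y') (by rw [P.HV.w, Category.assoc, hy']), 
    MorphismProperty.of_isPullback H' P.lfp, MorphismProperty.of_isPullback H' P.qc,
    MorphismProperty.of_isPullback HV' P.oi, MorphismProperty.of_isPullback sq P.qcV, H2, ?_⟩, s, sq, IsPullback.lift_fst ..⟩
  refine IsPullback.of_right (t := HV') ?_ (IsPullback.lift_snd ..)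
  rw [IsPullback.lift_fst, hy']
  exact P.HV

lemma pair_glue (i : I) {Z Z1 Z2 W : Scheme.{u}} (p : Z ⟶ Q.L) (s1 : Z1 ⟶ Z) (s2 : Z2 ⟶ Z) [IsOpenImmersion s1]
    [IsOpenImmersion s2] (hcov : ∀ z : Z, (∃ x, s1 x = z) ∨ (∃ x, s2 x = z))
    (w1 : W ⟶ Z1) (w2 : W ⟶ Z2) (HW : IsPullback w1 w2 s1 s2) (P1 : Q.Pair i (s1 ≫ p) w1)
    (P2 : Q.Pair i (s2 ≫ p) w2) (φ : P1.V ⟶ P2.V) [IsIso φ] (h1 : φ ≫ P2.v ≫ P2.g = P1.v ≫ P1.g)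
    (h2 : P1.w' ≫ φ = P2.w') : ∃ (Y : Scheme.{u}) (g : Y ⟶ Q.X i) (y : Z ⟶ Y), 
      LocallyOfFinitePresentation g ∧ QuasiCompact g ∧ IsPullback y p g (Q.π i) := by
  have := P1.lfp
  have := P1.qc
  have := P1.oi
  have := P2.lfp
  have := P2.qc
  have := P2.oi
  obtain ⟨Y, i1, i2, o1, o2, hi, hcovY, hint, hdesc⟩ := glue2 P1.v (φ ≫ P2.v)
  obtain ⟨g, hg1, hg2⟩ := hdesc P1.g P2.g (by rw [Category.assoc, h1])
  obtain ⟨y, hy1, hy2⟩ := glue_mor s1 s2 hcov w1 w2 HW (P1.y ≫ i1) (P2.y ≫ i2) (by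
    rw [← Category.assoc, ← Category.assoc, ← P1.HV.w, ← P2.HV.w, Category.assoc, hi, ← h2]
    simp only [Category.assoc])
  refine ⟨Y, g, y, ?_, ?_, ?_⟩
  · have := @HasRingHomProperty.instIsZariskiLocalAtSource.{u} @LocallyOfFinitePresentation _ inferInstance
    rw [IsZariskiLocalAtSource.iff_of_openCover (P := @LocallyOfFinitePresentation.{u}) (cov2 i1 i2 hcovY)]
    intro b
    change Bool at b
    rcases b with _ | _
    · change LocallyOfFinitePresentation (i1 ≫ g)
      rw [hg1]; exact P1.lfp
    · change LocallyOfFinitePresentation (i2 ≫ g)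
      rw [hg2]; exact P2.lfp
  · have : CompactSpace (Q.X i) := Q.comp i
    have : QuasiSeparatedSpace (Q.X i) := Q.qs i
    have c1 : CompactSpace P1.Y := QuasiCompact.compactSpace_of_compactSpace P1.g
    have c2 : CompactSpace P2.Y := QuasiCompact.compactSpace_of_compactSpace P2.g
    have : CompactSpace Y := by
      constructor
      have : (Set.univ : Set Y) = Set.range i1 ∪ Set.range i2 := by
        ext x; simpa using hcovY x
      rw [this]
      exact (isCompact_range i1.continuous).union (isCompact_range i2.continuous)
    infer_instance
  · have r1 : ∀ t, (∃ x, i1 x = y t) → ∃ x, s1 x = t := by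
      rintro t ⟨x, hx⟩
      rcases hcov t with h | ⟨z, rfl⟩
      · exact h
      · rw [← Scheme.Hom.comp_apply, hy2, Scheme.Hom.comp_apply] at hx
        obtain ⟨v, hv1, hv2⟩ := hint _ _ hx
        rw [Scheme.Hom.comp_apply] at hv2
        obtain ⟨u, hu1, hu2⟩ := Scheme.exists_preimage_of_isPullback P2.HV (φ v) z hv2
        refine ⟨w1 u, ?_⟩
        rw [← Scheme.Hom.comp_apply, HW.w, Scheme.Hom.comp_apply, hu2]
    have r2 : ∀ t, (∃ x, i2 x = y t) → ∃ x, s2 x = t := by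
      rintro t ⟨x, hx⟩
      rcases hcov t with ⟨z, rfl⟩ | h
      · rw [← Scheme.Hom.comp_apply, hy1, Scheme.Hom.comp_apply] at hx
        obtain ⟨v, hv1, hv2⟩ := hint _ _ hx.symm
        obtain ⟨u, hu1, hu2⟩ := Scheme.exists_preimage_of_isPullback P1.HV v z hv1
        refine ⟨w2 u, ?_⟩
        rw [← Scheme.Hom.comp_apply, ← HW.w, Scheme.Hom.comp_apply, hu2]
      · exact h
    refine isPullback_of_cover2 y p g (Q.π i) ?_ i1 i2 hcovY s1 P1.y s2 P2.y ?_ ?_ ?_ ?_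
    · apply hom_ext2 s1 s2 hcov
      · rw [reassoc_of% hy1, hg1, P1.H.w, Category.assoc]
      · rw [reassoc_of% hy2, hg2, P2.H.w, Category.assoc]
    · refine (IsOpenImmersion.isPullback _ _ _ _ hy1 ?_).flip
      ext t
      exact ⟨r1 t, fun ⟨x, hx⟩ => ⟨P1.y x, by rw [← hx, ← Scheme.Hom.comp_apply, ← hy1]; rfl⟩⟩
    · refine (IsOpenImmersion.isPullback _ _ _ _ hy2 ?_).flip
      ext t
      exact ⟨r2 t, fun ⟨x, hx⟩ => ⟨P2.y x, by rw [← hx, ← Scheme.Hom.comp_apply, ← hy2]; rfl⟩⟩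
    · rw [hg1]; exact P1.H
    · rw [hg2]; exact P2.H

variable [IsCodirectedOrder I] [Nonempty I]

/-- descent property -/
def Desc {Z : Scheme.{u}} (p : Z ⟶ Q.L) : Prop :=
  ∃ (i : I) (Y : Scheme.{u}) (g : Y ⟶ Q.X i) (y : Z ⟶ Y),
      LocallyOfFinitePresentation g ∧ QuasiCompact g ∧ IsPullback y p g (Q.π i)

lemma open_desc (hN : ∀ i, IsLocallyNoetherian (Q.X i)) {Z W : Scheme.{u}} (p : Z ⟶ Q.L) (hp : Q.Desc p)
    (w : W ⟶ Z) [IsOpenImmersion w] [CompactSpace W] : ∃ k, Nonempty (Q.Pair k p w) := by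
  obtain ⟨i, Y, g, y, h1, h2, H⟩ := hp
  have := hN i
  have h3 := quasiSep_of_lft g
  let B := Q.bcData i g h2 h3 y p H
  obtain ⟨k, V, hV, hk⟩ := B.E.exists_open (B.e.inv ⁻¹ᵁ w.opensRange) (by
    have : ((B.e.inv ⁻¹ᵁ w.opensRange : B.E.L.Opens) : Set B.E.L) = Set.range (w ≫ B.e.hom) := by
      ext t
      constructor
      · rintro ⟨x, hx⟩
        refine ⟨x, ?_⟩
        rw [Scheme.Hom.comp_apply, hx, ← Scheme.Hom.comp_apply]; simp
      · rintro ⟨x, rfl⟩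
        refine ⟨x, ?_⟩
        rw [← Scheme.Hom.comp_apply]; simp
    rw [this]
    exact isCompact_range (w ≫ B.e.hom).continuous)
  obtain ⟨y', hy', H'⟩ := Q.exists_lim k.2 g y p H (B.z k) (B.q k) (B.sq k)
  have ey : y' = B.e.hom ≫ B.E.π k := by
    apply (B.sq k).hom_ext
    · rw [hy', Category.assoc, B.π_z]
    · rw [H'.w, Category.assoc, B.π_q]
  have er : y' ⁻¹ᵁ V = w.opensRange := by
    rw [ey, Scheme.Hom.comp_preimage, hk, ← Scheme.Hom.comp_preimage]; simp
  have hw' : Set.range (w ≫ y') ⊆ Set.range V.ι := by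
    rintro _ ⟨x, rfl⟩
    have : w x ∈ y' ⁻¹ᵁ V := by rw [er]; exact ⟨x, rfl⟩
    rw [Scheme.Opens.range_ι]
    exact this
  have lfp : LocallyOfFinitePresentation (B.q k) := MorphismProperty.of_isPullback (B.sq k) h1
  have qc : QuasiCompact (B.q k) := MorphismProperty.of_isPullback (B.sq k) h2
  refine ⟨k, ⟨⟨_, V, B.q k, V.ι, y', IsOpenImmersion.lift V.ι (w ≫ y') hw', lfp, qc, inferInstance, ?_, H', ?_⟩⟩⟩
  · have : CompactSpace V := isCompact_iff_compactSpace.mp hV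
    have : QuasiSeparatedSpace (Q.X k.1) := Q.qs k.1
    infer_instance
  · refine IsOpenImmersion.isPullback _ _ _ _ (IsOpenImmersion.lift_fac ..).symm ?_
    rw [Scheme.Opens.opensRange_ι, er]

lemma glue_desc (hN : ∀ i, IsLocallyNoetherian (Q.X i)) {Z Z1 Z2 W : Scheme.{u}} (p : Z ⟶ Q.L) 
    (s1 : Z1 ⟶ Z) (s2 : Z2 ⟶ Z) [IsOpenImmersion s1]
    [IsOpenImmersion s2] (hcov : ∀ z : Z, (∃ x, s1 x = z) ∨ (∃ x, s2 x = z))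
    (w1 : W ⟶ Z1) (w2 : W ⟶ Z2) (HW : IsPullback w1 w2 s1 s2) [CompactSpace W]
    (h1 : Q.Desc (s1 ≫ p)) (h2 : Q.Desc (s2 ≫ p)) : Q.Desc p := by
  have : IsOpenImmersion w1 := MorphismProperty.of_isPullback HW.flip ‹IsOpenImmersion s2›
  have : IsOpenImmersion w2 := MorphismProperty.of_isPullback HW ‹IsOpenImmersion s1›
  obtain ⟨k1, ⟨P1⟩⟩ := Q.open_desc hN _ h1 w1
  obtain ⟨k2, ⟨P2⟩⟩ := Q.open_desc hN _ h2 w2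
  obtain ⟨i, hi1, hi2⟩ := exists_le_le k1 k2
  obtain ⟨P1, -⟩ := P1.mono hi1
  obtain ⟨P2, -⟩ := P2.mono hi2
  have ew : w1 ≫ s1 ≫ p = w2 ≫ s2 ≫ p := by rw [reassoc_of% HW.w]
  have key : ∀ {i : I} (P : Q.Pair i (s1 ≫ p) w1), LocallyOfFinitePresentation (P.v ≫ P.g) ∧ 
      QuasiCompact (P.v ≫ P.g) ∧ QuasiSeparated (P.v ≫ P.g) := by
    intro i P
    have := P.lfp
    have := P.oi
    have := hN i
    exact ⟨inferInstance, P.qcV, quasiSep_of_lft _⟩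
  have key' : ∀ {i : I} (P : Q.Pair i (s2 ≫ p) w2), LocallyOfFinitePresentation (P.v ≫ P.g) ∧ 
      QuasiCompact (P.v ≫ P.g) ∧ QuasiSeparated (P.v ≫ P.g) := by
    intro i P
    have := P.lfp
    have := P.oi
    have := hN i
    exact ⟨inferInstance, P.qcV, quasiSep_of_lft _⟩
  obtain ⟨a1, a2, a3⟩ := key P1
  obtain ⟨b1, b2, b3⟩ := key' P2
  obtain ⟨k, hk, hm⟩ := Q.mor_desc i (P1.v ≫ P1.g) P1.w' _ P1.hw (P2.v ≫ P2.g) P2.w' (by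
    rw [P2.hw.w, ew])
  obtain ⟨P1', t1, T1, e1⟩ := P1.mono hk
  obtain ⟨P2', t2, T2, e2⟩ := P2.mono hk
  obtain ⟨b, hb1, hb2⟩ := hm t1 _ P1'.w' T1 e1 P1'.hw.w
  obtain ⟨φ, hφ1, hφ2⟩ : ∃ φ : P1'.V ⟶ P2'.V, φ ≫ t2 = b ∧ φ ≫ P2'.v ≫ P2'.g = P1'.v ≫ P1'.g :=
    ⟨T2.lift b (P1'.v ≫ P1'.g) (by rw [hb2, T1.w]), IsPullback.lift_fst .., IsPullback.lift_snd ..⟩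
  have hφ3 : P1'.w' ≫ φ = P2'.w' := by
    apply T2.hom_ext
    · rw [Category.assoc, hφ1, hb1, e2]
    · rw [Category.assoc, hφ2, P1'.hw.w, P2'.hw.w, ew]
  obtain ⟨a1, a2, a3⟩ := key P1'
  obtain ⟨b1, b2, b3⟩ := key' P2'
  have := hN k
  obtain ⟨l, hl, hiso⟩ := Q.iso_desc2 k (P1'.v ≫ P1'.g) (P2'.v ≫ P2'.g) P1'.w' P2'.w' (w1 ≫ s1 ≫ p)
    P1'.hw (by rw [ew]; exact P2'.hw) φ hφ2 hφ3
  obtain ⟨R1, r1, U1, f1⟩ := P1'.mono hl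
  obtain ⟨R2, r2, U2, f2⟩ := P2'.mono hl
  obtain ⟨ψ, hψ1, hψ2⟩ : ∃ ψ : R1.V ⟶ R2.V, ψ ≫ r2 = r1 ≫ φ ∧ ψ ≫ R2.v ≫ R2.g = R1.v ≫ R1.g :=
    ⟨U2.lift (r1 ≫ φ) (R1.v ≫ R1.g) (by rw [Category.assoc, hφ2, U1.w]), IsPullback.lift_fst .., IsPullback.lift_snd ..⟩
  have hψ3 : R1.w' ≫ ψ = R2.w' := by
    apply U2.hom_ext
    · rw [Category.assoc, hψ1, reassoc_of% f1, hφ3, f2]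
    · rw [Category.assoc, hψ2, R1.hw.w, R2.hw.w, ew]
  have : IsIso ψ := hiso r1 _ r2 _ U1 U2 ψ hψ1 hψ2
  obtain ⟨Y, g, y, h⟩ := Q.pair_glue l p s1 s2 hcov w1 w2 HW R1 R2 ψ hψ2 hψ3
  exact ⟨l, Y, g, y, h⟩

lemma desc_of_affine (hN : ∀ i, IsLocallyNoetherian (Q.X i)) {Z : Scheme.{u}} (p : Z ⟶ Q.L)
    [CompactSpace Z] [QuasiSeparatedSpace Z] (h : ∀ U : Z.affineOpens, Q.Desc (U.1.ι ≫ p))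
    (hbot : Q.Desc ((⊥ : Z.Opens).ι ≫ p)) : Q.Desc p := by
  have key : Q.Desc ((⊤ : Z.Opens).ι ≫ p) := by
    refine compact_open_induction_on (P := fun U => Q.Desc (U.ι ≫ p)) ⊤ isCompact_univ hbot ?_
    intro S hS U hSU
    have sq := isPullback_opens_inf_le (X := Z) (U := S) (V := U.1) (W := S ⊔ U.1) le_sup_left le_sup_right
    have : CompactSpace (S ⊓ U.1 : Z.Opens) := by
      apply isCompact_iff_compactSpace.mp
      exact hS.inter_of_isOpen U.2.isCompact S.2 U.1.2
    refine Q.glue_desc hN _ (Z.homOfLE le_sup_left) (Z.homOfLE le_sup_right) ?_ _ _ sq ?_ ?_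
    · rintro ⟨z, hz | hz⟩
      · left
        refine ⟨⟨z, hz⟩, ?_⟩
        exact (S ⊔ U.1).ι.injective ((Scheme.Hom.comp_apply _ _ _).symm.trans
          (congrArg (fun f => f.base ⟨z, hz⟩) (Scheme.homOfLE_ι ..)))
      · right
        refine ⟨⟨z, hz⟩, ?_⟩
        exact (S ⊔ U.1).ι.injective ((Scheme.Hom.comp_apply _ _ _).symm.trans
          (congrArg (fun f => f.base ⟨z, hz⟩) (Scheme.homOfLE_ι ..)))
    · rw [Scheme.homOfLE_ι_assoc]; exact hSU
    · rw [Scheme.homOfLE_ι_assoc]; exact h U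
  obtain ⟨i, Y, g, y, h1, h2, H⟩ := key
  refine ⟨i, Y, g, Z.topIso.inv ≫ y, h1, h2, ?_⟩
  refine H.of_iso (Z.topIso) (Iso.refl _) (Iso.refl _) (Iso.refl _) ?_ ?_ ?_ ?_
  · simp
  · simp
  · simp
  · simp
end ISys

/-- directed system of rings -/
structure RSys (I : Type u) [Preorder I] where
  R : I → CommRingCat.{u}
  m : ∀ {i j : I}, i ≤ j → (R j ⟶ R i)
  m_id : ∀ i, m (le_refl i) = 𝟙 _
  m_comp : ∀ {i j k : I} (h : i ≤ j) (h' : j ≤ k), m h' ≫ m h = m (h.trans h')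
  A : CommRingCat.{u}
  ι : ∀ i, R i ⟶ A
  w : ∀ {i j : I} (h : i ≤ j), m h ≫ ι i = ι j
  surj : ∀ a : A, ∃ i, ∃ x : R i, (ι i).hom x = a
  inj : ∀ (i) (x y : R i), (ι i).hom x = (ι i).hom y → ∃ (k : I) (h : k ≤ i), (m h).hom x = (m h).hom y

namespace RSys
variable {I : Type u} [Preorder I] (Q : RSys I) [IsCodirectedOrder I] 

lemma w_apply {i j : I} (h : i ≤ j) (x) : (Q.ι i).hom ((Q.m h).hom x) = (Q.ι j).hom x := by
  rw [← Q.w h]; rfl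

lemma ext {B : CommRingCat.{u}} (a b : Q.A ⟶ B) (h : ∀ i, Q.ι i ≫ a = Q.ι i ≫ b) : a = b := by
  ext x
  obtain ⟨i, x, rfl⟩ := Q.surj x
  exact congrArg (fun f => f.hom x) (h i)

lemma lift {B : CommRingCat.{u}} (a : ∀ i, Q.R i ⟶ B) (ha : ∀ {i j} (h : i ≤ j), Q.m h ≫ a i = a j) [Nonempty I] :
    ∃ l : Q.A ⟶ B, ∀ i, Q.ι i ≫ l = a i := by
  have ha' : ∀ {i j} (h : i ≤ j) x, (a i).hom ((Q.m h).hom x) = (a j).hom x := by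
    intro i j h x; rw [← ha h]; rfl
  have key : ∀ i j x y, (Q.ι i).hom x = (Q.ι j).hom y → (a i).hom x = (a j).hom y := by
    intro i j x y h
    obtain ⟨k, hi, hj⟩ := exists_le_le i j
    obtain ⟨l, hl, e⟩ := Q.inj k ((Q.m hi).hom x) ((Q.m hj).hom y) (by rw [w_apply, w_apply, h])
    rw [← ha' hi, ← ha' hj, ← ha' hl, e, ha' hl]
  choose i x hx using Q.surj
  let l (t : Q.A) := (a (i t)).hom (x t)
  have hl : ∀ j y, l ((Q.ι j).hom y) = (a j).hom y := fun j y => key _ _ _ _ (hx _)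
  have two : ∀ s t : Q.A, ∃ k, ∃ x y : Q.R k, (Q.ι k).hom x = s ∧ (Q.ι k).hom y = t := by
    intro s t
    obtain ⟨k, h1, h2⟩ := exists_le_le (i s) (i t)
    exact ⟨k, (Q.m h1).hom (x s), (Q.m h2).hom (x t), by rw [w_apply, hx], by rw [w_apply, hx]⟩
  refine ⟨CommRingCat.ofHom ⟨⟨⟨l, ?_⟩, ?_⟩, ?_, ?_⟩, ?_⟩
  · obtain ⟨j⟩ := ‹Nonempty I›
    rw [← (Q.ι j).hom.map_one, hl, map_one]
  · intro s t
    obtain ⟨k, x, y, rfl, rfl⟩ := two s t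
    change l _ = l _ * l _
    rw [← map_mul, hl, hl, hl, map_mul]
  · obtain ⟨j⟩ := ‹Nonempty I›
    change l 0 = 0
    rw [← (Q.ι j).hom.map_zero, hl, map_zero]
  · intro s t
    obtain ⟨k, x, y, rfl, rfl⟩ := two s t
    change l _ = l _ + l _
    rw [← map_add, hl, hl, hl, map_add]
  · intro j
    ext y
    exact hl j y

end RSys

/-- adjoint ring map -/
noncomputable def adjR {T : Scheme.{u}} {R : CommRingCat.{u}} (f : T ⟶ Spec R) : R ⟶ Γ(T, ⊤) :=
  (Scheme.ΓSpecIso R).inv ≫ f.appTop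

lemma adjR_spec {T : Scheme.{u}} {R : CommRingCat.{u}} (f : T ⟶ Spec R) :
    T.toSpecΓ ≫ Spec.map (adjR f) = f := by
  rw [adjR, Spec.map_comp, ← Scheme.toSpecΓ_naturality_assoc, ← Category.comp_id f]
  congr 1
  simp

lemma adjR_comp {T : Scheme.{u}} {R S : CommRingCat.{u}} (f : T ⟶ Spec R) (g : S ⟶ R) :
    adjR (f ≫ Spec.map g) = g ≫ adjR f := by
  rw [adjR, adjR, Scheme.Hom.comp_appTop, Scheme.ΓSpecIso_inv_naturality_assoc]

/-- system of spectra -/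
noncomputable def RSys.sys {I : Type u} [Preorder I] (Q : RSys I) [IsCodirectedOrder I] [Nonempty I] : ISys I where
  X i := Spec (Q.R i)
  map h := Spec.map (Q.m h)
  map_id i := by rw [Q.m_id, Spec.map_id]
  map_comp h h' := by rw [← Spec.map_comp, Q.m_comp]
  L := Spec Q.A
  π i := Spec.map (Q.ι i)
  w h := by rw [← Spec.map_comp, Q.w]
  lift {T} a h := by
    obtain ⟨l, hl⟩ := Q.lift (B := Γ(T, ⊤)) (fun i => adjR (a i)) (fun {i j} hij => by rw [← adjR_comp, h])
    refine ⟨T.toSpecΓ ≫ Spec.map l, fun i => ?_⟩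
    rw [Category.assoc, ← Spec.map_comp, hl, adjR_spec]
  ext {T} a b h := by
    rw [← adjR_spec a, ← adjR_spec b]
    congr 2
    apply Q.ext
    intro i
    rw [← adjR_comp, ← adjR_comp, h]
  aff h := inferInstance
  comp i := inferInstance
  qs i := inferInstance

/-- index type -/
abbrev FGI (A : Type u) [CommRing A] := {S : Subalgebra ℤ A // S.FG}ᵒᵈ

instance (A : Type u) [CommRing A] : IsCodirectedOrder (FGI A) where
  directed i j := ⟨OrderDual.toDual ⟨i.1 ⊔ j.1, i.2.sup j.2⟩, 
    (le_sup_left : i.1 ≤ i.1 ⊔ j.1), (le_sup_right : j.1 ≤ i.1 ⊔ j.1)⟩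

instance (A : Type u) [CommRing A] : Nonempty (FGI A) := ⟨OrderDual.toDual ⟨⊥, Subalgebra.fg_bot⟩⟩

/-- system of f.g. subrings -/
def fgR (A : Type u) [CommRing A] : RSys (FGI A) where
  R i := CommRingCat.of i.1
  m {i j} h := CommRingCat.ofHom (Subalgebra.inclusion (show j.1 ≤ i.1 from h)).toRingHom
  m_id i := rfl
  m_comp h h' := rfl
  A := CommRingCat.of A
  ι i := CommRingCat.ofHom i.1.val.toRingHom
  w h := rfl
  surj a := ⟨OrderDual.toDual ⟨Algebra.adjoin ℤ {a}, {a}, by simp⟩,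
    ⟨a, Algebra.subset_adjoin rfl⟩, rfl⟩
  inj i x y h := ⟨i, le_refl i, by rw [Subtype.ext h]⟩

lemma fg_noeth (A : Type u) [CommRing A] (i : FGI A) : IsNoetherianRing i.1 := by
  have : Algebra.FiniteType ℤ i.1 := (Subalgebra.fg_iff_finiteType i.1).mp i.2
  exact Algebra.FiniteType.isNoetherianRing ℤ i.1

lemma fp_model (A B : Type u) [CommRing A] [CommRing B] [Algebra A B] [Algebra.FinitePresentation A B] :
    ∃ (i : FGI A) (M : CommRingCat.{u}) (a : CommRingCat.of i.1 ⟶ M) (b : M ⟶ CommRingCat.of B), 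
      a.hom.FinitePresentation ∧ IsPushout ((fgR A).ι i) a (CommRingCat.ofHom (algebraMap A B)) b := by
  obtain ⟨n, m, ⟨P⟩⟩ := Algebra.Presentation.exists_presentation_fin A B
  let i : FGI A := OrderDual.toDual ⟨P.core, P.finite_coeffs.toFinset, by simp [Algebra.Presentation.core]⟩
  have : P.HasCoeffs P.core := ⟨fun x hx => ⟨⟨x, P.coeffs_subset_core hx⟩, rfl⟩⟩
  let e := P.tensorModelOfHasCoeffsEquiv P.core
  refine ⟨i, CommRingCat.of (P.ModelOfHasCoeffs P.core), CommRingCat.ofHom (algebraMap P.core _), 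
    CommRingCat.ofHom (e.toRingEquiv.toRingHom.comp (Algebra.TensorProduct.includeRight : 
      P.ModelOfHasCoeffs P.core →ₐ[P.core] TensorProduct P.core A (P.ModelOfHasCoeffs P.core)).toRingHom), ?_, ?_⟩
  · change (algebraMap P.core (P.ModelOfHasCoeffs P.core)).FinitePresentation
    rw [RingHom.finitePresentation_algebraMap]
    infer_instance
  · refine (CommRingCat.isPushout_tensorProduct P.core A (P.ModelOfHasCoeffs P.core)).of_iso 
      (Iso.refl _) (Iso.refl _) (Iso.refl _) e.toRingEquiv.toCommRingCatIso ?_ ?_ ?_ ?_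
    · rfl
    · rfl
    · ext x; exact e.commutes x
    · rfl

lemma fg_desc_affine (A : Type u) [CommRing A] {Z : Scheme.{u}} [IsAffine Z] (p : Z ⟶ Spec (CommRingCat.of A))
    [hp : LocallyOfFinitePresentation p] : (fgR A).sys.Desc p := by
  obtain ⟨ψ, hψ⟩ : ∃ ψ : CommRingCat.of A ⟶ Γ(Z, ⊤), Z.isoSpec.hom ≫ Spec.map ψ = p := ⟨_, adjR_spec p⟩
  have hfp : LocallyOfFinitePresentation (Spec.map ψ) := by
    have : Spec.map ψ = Z.isoSpec.inv ≫ p := by rw [← hψ, Iso.inv_hom_id_assoc]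
    rw [this]; infer_instance
  have hfp : ψ.hom.FinitePresentation := 
    (HasRingHomProperty.Spec_iff (P := @LocallyOfFinitePresentation)).mp hfp
  letI : Algebra A Γ(Z, ⊤) := ψ.hom.toAlgebra
  have : Algebra.FinitePresentation A Γ(Z, ⊤) := hfp
  obtain ⟨i, M, a, b, h1, po⟩ := fp_model A Γ(Z, ⊤)
  have pb := isPullback_SpecMap_of_isPushout _ _ _ _ po
  refine ⟨i, Spec M, Spec.map a, Z.isoSpec.hom ≫ Spec.map b, ?_, ?_, ?_⟩
  · exact (HasRingHomProperty.Spec_iff (P := @LocallyOfFinitePresentation)).mpr h1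
  · exact inferInstanceAs (QuasiCompact (Spec.map a))
  · refine pb.flip.of_iso Z.isoSpec.symm (Iso.refl _) (Iso.refl _) (Iso.refl _) ?_ ?_ ?_ ?_
    · exact (Category.comp_id _).trans (Iso.inv_hom_id_assoc _ _).symm
    · exact (Category.comp_id _).trans ((Iso.inv_hom_id_assoc _ _).symm.trans (congrArg _ hψ))
    · exact (Category.comp_id _).trans (Category.id_comp _).symm
    · exact (Category.comp_id _).trans (Category.id_comp _).symm

lemma fg_desc (A : Type u) [CommRing A] {Z : Scheme.{u}} (p : Z ⟶ Spec (CommRingCat.of A)) [CompactSpace Z] 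
    [QuasiSeparatedSpace Z]
    [hp : LocallyOfFinitePresentation p] : (fgR A).sys.Desc p := by
  apply ISys.desc_of_affine
  · intro i
    have := fg_noeth A i
    exact inferInstanceAs (IsLocallyNoetherian (Spec (CommRingCat.of i.1)))
  · intro U
    have : IsAffine U.1 := U.2
    exact fg_desc_affine A (U.1.ι ≫ p : _ ⟶ Spec (CommRingCat.of A))
  · have : IsAffine (⊥ : Z.Opens) := isAffineOpen_bot Z
    exact fg_desc_affine A ((⊥ : Z.Opens).ι ≫ p : _ ⟶ Spec (CommRingCat.of A))

section Ult
variable {J : Type u} (U : Ultrafilter J) (F : J → Type u) [∀ l, CommRing (F l)]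

/-- null ideal -/
def ultI : Ideal (∀ l, F l) where
  carrier := {f | {l | f l = 0} ∈ U}
  add_mem' {a b} ha hb := by
    filter_upwards [ha, hb] with l h1 h2
    change a l + b l = 0
    rw [show a l = 0 from h1, show b l = 0 from h2, add_zero]
  zero_mem' := Filter.Eventually.of_forall (f := (U : Filter J)) (p := fun l => (0 : ∀ l, F l) l = 0) fun l => rfl
  smul_mem' c {x} hx := by
    filter_upwards [hx] with l h1
    change c l * x l = 0
    rw [show x l = 0 from h1, mul_zero]

lemma mem_ultI (f : ∀ l, F l) : f ∈ ultI U F ↔ ∀ᶠ l in U, f l = 0 := Iff.rfl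

/-- ultraproduct -/
abbrev ultA := (∀ l, F l) ⧸ ultI U F

variable {U F} in
lemma ult_eq (f g : ∀ l, F l) :
    Ideal.Quotient.mk (ultI U F) f = Ideal.Quotient.mk (ultI U F) g ↔ ∀ᶠ l in U, f l = g l := by
  rw [Ideal.Quotient.eq, mem_ultI]
  simp only [Pi.sub_apply, sub_eq_zero]

variable {U F} in
lemma ult_eq0 (f : ∀ l, F l) :
    Ideal.Quotient.mk (ultI U F) f = 0 ↔ ∀ᶠ l in U, f l = 0 := by
  rw [Ideal.Quotient.eq_zero_iff_mem, mem_ultI]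

open Classical in
/-- extension by zero -/
noncomputable def ultExt (S : Set J) (f : ∀ l : S, F l) : ∀ l, F l :=
  fun l => if h : l ∈ S then f ⟨l, h⟩ else 0

variable {F} in
lemma ultExt_of (S : Set J) (f : ∀ l : S, F l) (l : J) (h : l ∈ S) : ultExt F S f l = f ⟨l, h⟩ :=
  dif_pos h

/-- structure map -/
noncomputable def ultIota (S : {S : Set J // S ∈ U}) : (∀ l : S.1, F l) →+* ultA U F where
  toFun f := Ideal.Quotient.mk _ (ultExt F S.1 f)
  map_one' := by
    rw [← map_one (Ideal.Quotient.mk _), ult_eq]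
    filter_upwards [S.2] with l hl
    rw [ultExt_of _ _ _ hl]; rfl
  map_zero' := by
    rw [← map_zero (Ideal.Quotient.mk _), ult_eq]
    filter_upwards [S.2] with l hl
    rw [ultExt_of _ _ _ hl]; rfl
  map_mul' a b := by
    rw [← map_mul (Ideal.Quotient.mk _), ult_eq]
    filter_upwards [S.2] with l hl
    rw [Pi.mul_apply, ultExt_of _ _ _ hl, ultExt_of _ _ _ hl, ultExt_of _ _ _ hl]; rfl
  map_add' a b := by
    rw [← map_add (Ideal.Quotient.mk _), ult_eq]
    filter_upwards [S.2] with l hl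
    rw [Pi.add_apply, ultExt_of _ _ _ hl, ultExt_of _ _ _ hl, ultExt_of _ _ _ hl]; rfl

lemma ultIota_apply (S : {S : Set J // S ∈ U}) (f) :
  ultIota U F S f = Ideal.Quotient.mk _ (ultExt F S.1 f) := rfl

/-- restriction -/
def ultRes {S T : Set J} (h : S ⊆ T) : (∀ l : T, F l) →+* (∀ l : S, F l) :=
  Pi.ringHom fun l => Pi.evalRingHom (fun l : T => F l) ⟨l.1, h l.2⟩

lemma ultRes_apply {S T : Set J} (h : S ⊆ T) (f : ∀ l : T, F l) (l : S) :
   ultRes F h f l = f ⟨l.1, h l.2⟩ := rfl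

instance : IsCodirectedOrder {S : Set J // S ∈ U} :=
  ⟨fun S T => ⟨⟨S.1 ∩ T.1, Filter.inter_mem S.2 T.2⟩, Set.inter_subset_left, Set.inter_subset_right⟩⟩
instance : Nonempty {S : Set J // S ∈ U} := ⟨⟨Set.univ, Filter.univ_mem⟩⟩

/-- ultraproduct as a colimit -/
noncomputable def ultR : RSys {S : Set J // S ∈ U} where
  R S := CommRingCat.of (∀ l : S.1, F l)
  m h := CommRingCat.ofHom (ultRes F h)
  m_id _ := rfl
  m_comp _ _ := rfl
  A := CommRingCat.of (ultA U F)
  ι S := CommRingCat.ofHom (ultIota U F S)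
  w {S T} h := by
    ext f
    change ultIota U F S _ = ultIota U F T f
    rw [ultIota_apply, ultIota_apply, ult_eq]
    filter_upwards [S.2] with l hl
    rw [ultExt_of _ _ _ hl, ultExt_of _ _ _ (h hl)]
    rfl
  surj a := by
    obtain ⟨f, rfl⟩ := Ideal.Quotient.mk_surjective a
    refine ⟨⟨Set.univ, Filter.univ_mem⟩, fun l => f l, ?_⟩
    change ultIota U F _ _ = _
    rw [ultIota_apply, ult_eq]
    exact Filter.Eventually.of_forall fun l => ultExt_of _ _ l (Set.mem_univ l)
  inj S x y h := by
    change ultIota U F _ _ = ultIota U F _ _ at h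
    rw [ultIota_apply, ultIota_apply, ult_eq] at h
    refine ⟨⟨_, Filter.inter_mem S.2 h⟩, Set.inter_subset_left, ?_⟩
    change ultRes F (Set.inter_subset_left) x = ultRes F (Set.inter_subset_left) y
    funext l
    have := l.2.2
    simp only [Set.mem_setOf_eq] at this
    rw [ultExt_of _ _ _ l.2.1, ultExt_of _ _ _ l.2.1] at this
    exact this

variable {F} {F' : J → Type u} [∀ l, CommRing (F' l)] (φ : ∀ l, F l →+* F' l)

/-- product map -/
def piMap (S : Set J) : (∀ l : S, F l) →+* (∀ l : S, F' l) :=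
  Pi.ringHom fun l => (φ l).comp (Pi.evalRingHom (fun l : S => F l) l)

/-- induced map -/
def ultMap : ultA U F →+* ultA U F' :=
  Ideal.quotientMap _ (Pi.ringHom fun l => (φ l).comp (Pi.evalRingHom F l)) (by
    intro f hf
    change ∀ᶠ l in U, φ l (f l) = 0
    rw [mem_ultI] at hf
    filter_upwards [hf] with l hl
    rw [hl, map_zero])

lemma ultMap_mk (f : ∀ l, F l) : ultMap U φ (Ideal.Quotient.mk _ f) = Ideal.Quotient.mk _ fun l => φ l (f l) :=
  rfl

lemma ultMap_iota (S : {S : Set J // S ∈ U}) :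
    (ultMap U φ).comp (ultIota U F S) = (ultIota U F' S).comp (piMap φ S.1) := by
  ext f
  change ultMap U φ (ultIota U F S f) = ultIota U F' S _
  rw [ultIota_apply, ultIota_apply, ultMap_mk, ult_eq]
  filter_upwards [S.2] with l hl
  rw [ultExt_of _ _ _ hl, ultExt_of _ _ _ hl]
  rfl

end Ult

section UltV
variable {J : Type u} (U : Ultrafilter J)

lemma ult_domain (R : J → Type u) [∀ l, CommRing (R l)] [∀ l, IsDomain (R l)] : IsDomain (ultA U R) := by
  haveI : Nontrivial (ultA U R) := ⟨0, 1, by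
    rw [ne_comm, ← map_one (Ideal.Quotient.mk _), Ne, ult_eq0]
    intro h
    obtain ⟨l, hl⟩ := h.exists
    exact one_ne_zero hl⟩
  haveI : NoZeroDivisors (ultA U R) := ⟨by
    intro a b h
    obtain ⟨a, rfl⟩ := Ideal.Quotient.mk_surjective a
    obtain ⟨b, rfl⟩ := Ideal.Quotient.mk_surjective b
    rw [← map_mul, ult_eq0] at h
    rw [ult_eq0, ult_eq0, ← Ultrafilter.eventually_or]
    filter_upwards [h] with l hl
    exact mul_eq_zero.mp hl⟩
  exact NoZeroDivisors.to_isDomain _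

lemma ult_field (K : J → Type u) [∀ l, Field (K l)] : IsField (ultA U K) where
  exists_pair_ne := (ult_domain U K).toNontrivial.exists_pair_ne
  mul_comm := mul_comm
  mul_inv_cancel {a} ha := by
    obtain ⟨a, rfl⟩ := Ideal.Quotient.mk_surjective a
    refine ⟨Ideal.Quotient.mk _ fun l => (a l)⁻¹, ?_⟩
    rw [Ne, ult_eq0, ← Ultrafilter.eventually_not] at ha
    rw [← map_mul, ← map_one (Ideal.Quotient.mk _), ult_eq]
    filter_upwards [ha] with l hl
    exact mul_inv_cancel₀ hl

lemma ult_val (R : J → Type u) [∀ l, CommRing (R l)] [∀ l, IsDomain (R l)] [∀ l, ValuationRing (R l)]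
   [IsDomain (ultA U R)] : ValuationRing (ultA U R) := by
  refine (ValuationRing.iff_dvd_total).mpr ⟨?_⟩
  intro a b
  obtain ⟨a, rfl⟩ := Ideal.Quotient.mk_surjective a
  obtain ⟨b, rfl⟩ := Ideal.Quotient.mk_surjective b
  change Ideal.Quotient.mk _ a ∣ Ideal.Quotient.mk _ b ∨ Ideal.Quotient.mk _ b ∣ Ideal.Quotient.mk _ a
  have := fun l => ValuationRing.cond (a l) (b l)
  choose c hc using this
  have hc' := Filter.Eventually.of_forall (f := (U : Filter J)) hc
  rw [Ultrafilter.eventually_or] at hc'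
  rcases hc' with h | h
  · left
    exact ⟨Ideal.Quotient.mk _ c, by rw [← map_mul, ult_eq]; filter_upwards [h] with l hl; exact hl.symm⟩
  · right
    exact ⟨Ideal.Quotient.mk _ c, by rw [← map_mul, ult_eq]; filter_upwards [h] with l hl; exact hl.symm⟩

lemma ult_frac (R : J → Type u) [∀ l, CommRing (R l)] [∀ l, IsDomain (R l)]
   (K : J → Type u) [∀ l, Field (K l)] [∀ l, Algebra (R l) (K l)] [∀ l, IsFractionRing (R l) (K l)] :
   @IsFractionRing (ultA U R) _ (ultA U K) _ (ultMap U fun l => algebraMap (R l) (K l)).toAlgebra := by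
  letI := (ultMap U fun l => algebraMap (R l) (K l)).toAlgebra
  have hm : ∀ f : ∀ l, R l, algebraMap (ultA U R) (ultA U K) (Ideal.Quotient.mk _ f) =
    Ideal.Quotient.mk _ fun l => algebraMap (R l) (K l) (f l) := fun f => rfl
  haveI := ult_domain U R
  have hinj : ∀ x y, algebraMap (ultA U R) (ultA U K) x = algebraMap (ultA U R) (ultA U K) y → x = y := by
    intro x y h
    obtain ⟨x, rfl⟩ := Ideal.Quotient.mk_surjective x
    obtain ⟨y, rfl⟩ := Ideal.Quotient.mk_surjective y
    rw [hm, hm, ult_eq] at h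
    rw [ult_eq]
    filter_upwards [h] with l hl
    exact IsFractionRing.injective (R l) (K l) hl
  change IsLocalization _ _
  refine ⟨?_, ?_, ?_⟩
  · rintro ⟨y, hy⟩
    refine (ult_field U K).mul_inv_cancel (a := algebraMap (ultA U R) (ultA U K) y) ?_ |>.elim
      (fun z hz => IsUnit.of_mul_eq_one z hz)
    intro h
    rw [← map_zero (algebraMap (ultA U R) (ultA U K))] at h
    exact nonZeroDivisors.ne_zero hy (hinj _ _ h)
  · intro z
    obtain ⟨z, rfl⟩ := Ideal.Quotient.mk_surjective z
    have := fun l => IsLocalization.surj (nonZeroDivisors (R l)) (z l)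
    choose x hx using this
    refine ⟨⟨Ideal.Quotient.mk _ fun l => (x l).1, ⟨Ideal.Quotient.mk _ fun l => (x l).2.1, ?_⟩⟩, ?_⟩
    · rw [mem_nonZeroDivisors_iff_ne_zero, Ne, ult_eq0, ← Ultrafilter.eventually_not]
      exact Filter.Eventually.of_forall fun l => nonZeroDivisors.ne_zero (x l).2.2
    · change _ * algebraMap (ultA U R) (ultA U K) _ = algebraMap (ultA U R) (ultA U K) _
      rw [hm, hm, ← map_mul]
      congr 1
      funext l
      exact hx l
  · intro x y h
    exact ⟨1, by rw [hinj _ _ h]⟩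

/-- valuative square from ultraproducts -/
noncomputable def ultSq (R : J → Type u) [∀ l, CommRing (R l)] [∀ l, IsDomain (R l)] [∀ l, ValuationRing (R l)]
   (K : J → Type u) [∀ l, Field (K l)] [∀ l, Algebra (R l) (K l)] [∀ l, IsFractionRing (R l) (K l)]
   {X Y : Scheme.{u}} (f : X ⟶ Y)
   (i₁ : Spec (.of (ultA U K)) ⟶ X) (i₂ : Spec (.of (ultA U R)) ⟶ Y)
   (w : i₁ ≫ f = Spec.map (CommRingCat.ofHom (ultMap U fun l => algebraMap (R l) (K l))) ≫ i₂) :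
   ValuativeCommSq f :=
  letI := (ultMap U fun l => algebraMap (R l) (K l)).toAlgebra
  haveI := ult_domain U R
  @ValuativeCommSq.mk _ _ f (ultA U R) _ _ (ult_val U R) (ultA U K) (ult_field U K).toField
    (ultMap U fun l => algebraMap (R l) (K l)).toAlgebra (ult_frac U R K) i₁ i₂ ⟨w⟩

end UltV

lemma ult_exist {X Y : Scheme.{u}} (f : X ⟶ Y) (hf : ValuativeCriterion.Existence f)
   {J : Type u} (U : Ultrafilter J) (R : J → Type u) [∀ l, CommRing (R l)] [∀ l, IsDomain (R l)] [∀ l, ValuationRing (R l)]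
   (K : J → Type u) [∀ l, Field (K l)] [∀ l, Algebra (R l) (K l)] [∀ l, IsFractionRing (R l) (K l)]
   (i₁ : Spec (.of (ultA U K)) ⟶ X) (i₂ : Spec (.of (ultA U R)) ⟶ Y)
   (w : i₁ ≫ f = Spec.map (CommRingCat.ofHom (ultMap U fun l => algebraMap (R l) (K l))) ≫ i₂) :
   ∃ a : Spec (.of (ultA U R)) ⟶ X, a ≫ f = i₂ ∧
     Spec.map (CommRingCat.ofHom (ultMap U fun l => algebraMap (R l) (K l))) ≫ a = i₁ := by
  obtain ⟨⟨a, h1, h2⟩⟩ := hf (ultSq U R K f i₁ i₂ w)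
  exact ⟨a, h2, h1⟩

lemma ult_unique {X Y : Scheme.{u}} (f : X ⟶ Y) (hf : ValuativeCriterion.Uniqueness f)
   {J : Type u} (U : Ultrafilter J) (R : J → Type u) [∀ l, CommRing (R l)] [∀ l, IsDomain (R l)] [∀ l, ValuationRing (R l)]
   (K : J → Type u) [∀ l, Field (K l)] [∀ l, Algebra (R l) (K l)] [∀ l, IsFractionRing (R l) (K l)]
   (a b : Spec (.of (ultA U R)) ⟶ X) (h1 : a ≫ f = b ≫ f)
   (h2 : Spec.map (CommRingCat.ofHom (ultMap U fun l => algebraMap (R l) (K l))) ≫ a =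
     Spec.map (CommRingCat.ofHom (ultMap U fun l => algebraMap (R l) (K l))) ≫ b) : a = b := by
  have := hf (ultSq U R K f _ (a ≫ f) (by rw [← Category.assoc]))
  have h := this.elim ⟨a, rfl, rfl⟩ ⟨b, h2.symm, h1.symm⟩
  exact congrArg (·.l) h

section
variable {J : Type u} {F : J → Type u} [∀ l, CommRing (F l)]

/-- evaluation -/
def ev (F : J → Type u) [∀ l, CommRing (F l)] (S : Set J) (l : J) (h : l ∈ S) :
    CommRingCat.of (∀ l : S, F l) ⟶ CommRingCat.of (F l) :=
  CommRingCat.ofHom (Pi.evalRingHom (fun l : S => F l) ⟨l, h⟩)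

lemma ev_inj {X : Scheme.{u}} [QuasiSeparatedSpace X] (S : Set J)
    (a b : Spec (CommRingCat.of (∀ l : S, F l)) ⟶ X)
    (h : ∀ l hl, Spec.map (ev F S l hl) ≫ a = Spec.map (ev F S l hl) ≫ b) : a = b :=
  pointsPi_injective (fun l : S => CommRingCat.of (F l)) X (funext fun l => h l.1 l.2)

lemma ev_surj {X : Scheme.{u}} [CompactSpace X] [∀ l, IsLocalRing (F l)] (S : Set J)
    (r : ∀ l, l ∈ S → (Spec (CommRingCat.of (F l)) ⟶ X)) :
    ∃ a : Spec (CommRingCat.of (∀ l : S, F l)) ⟶ X,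
      ∀ l hl, Spec.map (ev F S l hl) ≫ a = r l hl := by
  obtain ⟨a, ha⟩ := pointsPi_surjective (fun l : S => CommRingCat.of (F l)) X (fun l => r l.1 l.2)
  exact ⟨a, fun l hl => congrFun ha ⟨l, hl⟩⟩

lemma ev_res {S T : Set J} (h : S ⊆ T) (l : J) (hl : l ∈ S) :
    CommRingCat.ofHom (ultRes F h) ≫ ev F S l hl = ev F T l (h hl) := rfl

lemma spec_ev_res {S T : Set J} (h : S ⊆ T) (l : J) (hl : l ∈ S) {Z : Scheme.{u}}
   (z : Spec (CommRingCat.of (∀ l : T, F l)) ⟶ Z) :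
    Spec.map (ev F S l hl) ≫ Spec.map (CommRingCat.ofHom (ultRes F h)) ≫ z =
      Spec.map (ev F T l (h hl)) ≫ z := by
  rw [← Spec.map_comp_assoc, ev_res]

variable {F' : J → Type u} [∀ l, CommRing (F' l)] (φ : ∀ l, F l →+* F' l)

lemma spec_ev_pi {S : Set J} (l : J) (hl : l ∈ S) {Z : Scheme.{u}}
   (z : Spec (CommRingCat.of (∀ l : S, F l)) ⟶ Z) :
    Spec.map (ev F' S l hl) ≫ Spec.map (CommRingCat.ofHom (piMap φ S)) ≫ z =
      Spec.map (CommRingCat.ofHom (φ l)) ≫ Spec.map (ev F S l hl) ≫ z := by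
  rw [← Spec.map_comp_assoc, ← Spec.map_comp_assoc]
  rfl

lemma spec_iota_pi (U : Ultrafilter J) (S : {S : Set J // S ∈ U}) {Z : Scheme.{u}}
   (z : Spec (CommRingCat.of (∀ l : S.1, F l)) ⟶ Z) :
    Spec.map (CommRingCat.ofHom (ultIota U F' S)) ≫ Spec.map (CommRingCat.ofHom (piMap φ S.1)) ≫ z =
      Spec.map (CommRingCat.ofHom (ultMap U φ)) ≫ Spec.map (CommRingCat.ofHom (ultIota U F S)) ≫ z := by
  rw [← Spec.map_comp_assoc, ← Spec.map_comp_assoc, ← CommRingCat.ofHom_comp, ← CommRingCat.ofHom_comp,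
    ultMap_iota]

lemma spec_iota_res (U : Ultrafilter J) (S T : {S : Set J // S ∈ U}) (h : S.1 ⊆ T.1) {Z : Scheme.{u}}
   (z : Spec (CommRingCat.of (∀ l : T.1, F l)) ⟶ Z) :
    Spec.map (CommRingCat.ofHom (ultIota U F S)) ≫ Spec.map (CommRingCat.ofHom (ultRes F h)) ≫ z =
      Spec.map (CommRingCat.ofHom (ultIota U F T)) ≫ z := by
  rw [← Spec.map_comp_assoc]
  exact congrArg (fun t => Spec.map t ≫ z) ((ultR U F).w h)

lemma ult_desc (U : Ultrafilter J) (T : {S : Set J // S ∈ U}) {X Y : Scheme.{u}}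
    (s : Spec (CommRingCat.of (∀ l : T.1, F l)) ⟶ X) (g : Y ⟶ X) [LocallyOfFinitePresentation g]
    (a : Spec (CommRingCat.of (ultA U F)) ⟶ Y)
    (ha : a ≫ g = Spec.map (CommRingCat.ofHom (ultIota U F T)) ≫ s) :
    ∃ (S : {S : Set J // S ∈ U}) (h : S.1 ⊆ T.1) (b : Spec (CommRingCat.of (∀ l : S.1, F l)) ⟶ Y),
      Spec.map (CommRingCat.ofHom (ultIota U F S)) ≫ b = a ∧
      b ≫ g = Spec.map (CommRingCat.ofHom (ultRes F h)) ≫ s :=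
  (ultR U F).sys.hom_desc T s g a ha

lemma ult_homeq (U : Ultrafilter J) (T : {S : Set J // S ∈ U}) {X Y : Scheme.{u}}
    (g : Y ⟶ X) [LocallyOfFiniteType g]
    (a b : Spec (CommRingCat.of (∀ l : T.1, F l)) ⟶ Y) (h : a ≫ g = b ≫ g)
    (hab : Spec.map (CommRingCat.ofHom (ultIota U F T)) ≫ a =
      Spec.map (CommRingCat.ofHom (ultIota U F T)) ≫ b) :
    ∃ (S : {S : Set J // S ∈ U}) (h : S.1 ⊆ T.1), Spec.map (CommRingCat.ofHom (ultRes F h)) ≫ a =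
      Spec.map (CommRingCat.ofHom (ultRes F h)) ≫ b :=
  (ultR U F).sys.hom_eq T g a b h hab

/-- tail -/
def tl {I : Type u} [Preorder I] (c : J → I) (U : Ultrafilter J) (hU : ∀ k, {l | c l ≤ k} ∈ U) (k : I) :
   {S : Set J // S ∈ U} := ⟨_, hU k⟩

lemma mem_tl {I : Type u} [Preorder I] {c : J → I} {U : Ultrafilter J} {hU : ∀ k, {l | c l ≤ k} ∈ U} {k : I} {l : J} :
   l ∈ (tl c U hU k).1 ↔ c l ≤ k := Iff.rfl

lemma ult_lim {I : Type u} [Preorder I] (Q : ISys I) (c : J → I) (U : Ultrafilter J)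
    (hU : ∀ k, {l | c l ≤ k} ∈ U) [∀ l, IsLocalRing (F l)]
    (r : ∀ l, Spec (CommRingCat.of (F l)) ⟶ Q.X (c l)) :
    ∃ (ρ : Spec (CommRingCat.of (ultA U F)) ⟶ Q.L)
      (x : ∀ k, Spec (CommRingCat.of (∀ l : (tl c U hU k).1, F l)) ⟶ Q.X k),
      (∀ k, ρ ≫ Q.π k = Spec.map (CommRingCat.ofHom (ultIota U F (tl c U hU k))) ≫ x k) ∧
      ∀ k l (h : c l ≤ k) (h' : l ∈ (tl c U hU k).1), Spec.map (ev F (tl c U hU k).1 l h') ≫ x k = r l ≫ Q.map h := by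
  have := fun k => by
    haveI := Q.comp k
    exact ev_surj (tl c U hU k).1 (fun l hl => r l ≫ Q.map (mem_tl.1 hl))
  choose x hx using this
  obtain ⟨ρ, hρ⟩ := Q.lift (fun k => Spec.map (CommRingCat.ofHom (ultIota U F (tl c U hU k))) ≫ x k) (by
    intro k k' h
    haveI := Q.qs k'
    have hle : (tl c U hU k).1 ⊆ (tl c U hU k').1 := fun l hl => mem_tl.2 ((mem_tl.1 hl).trans h)
    rw [← spec_iota_res U _ _ hle, Category.assoc]
    congr 1
    refine ev_inj _ _ _ fun l hl => ?_
    rw [spec_ev_res, hx, ← Category.assoc, hx, Category.assoc, Q.map_comp])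
  exact ⟨ρ, x, hρ, fun k l h h' => hx k l h'⟩

lemma ult_existence {I : Type u} [Preorder I] (Q : ISys I) (c : J → I) (U : Ultrafilter J)
    (hU : ∀ k, {l | c l ≤ k} ∈ U) {i : I} (hc : ∀ l, c l ≤ i)
    {Y Z : Scheme.{u}} (g : Y ⟶ Q.X i) [LocallyOfFinitePresentation g] [QuasiCompact g] (y : Z ⟶ Y) (p : Z ⟶ Q.L)
    (H : IsPullback y p g (Q.π i)) (hp : ValuativeCriterion.Existence p)
    (R : J → Type u) [∀ l, CommRing (R l)] [∀ l, IsDomain (R l)] [∀ l, ValuationRing (R l)]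
    (K : J → Type u) [∀ l, Field (K l)] [∀ l, Algebra (R l) (K l)] [∀ l, IsFractionRing (R l) (K l)]
    (r : ∀ l, Spec (CommRingCat.of (R l)) ⟶ Q.X (c l))
    (k : ∀ l, Spec (CommRingCat.of (K l)) ⟶ Y)
    (w : ∀ l, k l ≫ g = Spec.map (CommRingCat.ofHom (algebraMap (R l) (K l))) ≫ r l ≫ Q.map (hc l)) :
    ∃ l, ∃ b : Spec (CommRingCat.of (R l)) ⟶ Y, b ≫ g = r l ≫ Q.map (hc l) ∧
      Spec.map (CommRingCat.ofHom (algebraMap (R l) (K l))) ≫ b = k l := by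
  obtain ⟨ρ, x, hρ, hx⟩ := ult_lim Q c U hU r
  haveI := Q.comp i
  haveI := Q.qs i
  haveI : CompactSpace Y := QuasiCompact.compactSpace_of_compactSpace g
  obtain ⟨κ, hκ⟩ := ev_surj (F := K) (tl c U hU i).1 (fun l _ => k l)
  have e1 : κ ≫ g = Spec.map (CommRingCat.ofHom (piMap (fun l => algebraMap (R l) (K l)) _)) ≫ x i := by
    refine ev_inj _ _ _ fun l hl => ?_
    rw [spec_ev_pi, ← Category.assoc, hκ, w, hx _ _ (hc l)]
  obtain ⟨i₁, h1, h2⟩ : ∃ i₁ : Spec (.of (ultA U K)) ⟶ Z,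
      i₁ ≫ y = Spec.map (CommRingCat.ofHom (ultIota U K (tl c U hU i))) ≫ κ ∧
      i₁ ≫ p = Spec.map (CommRingCat.ofHom (ultMap U fun l => algebraMap (R l) (K l))) ≫ ρ := by
    have : (Spec.map (CommRingCat.ofHom (ultIota U K (tl c U hU i))) ≫ κ) ≫ g =
       (Spec.map (CommRingCat.ofHom (ultMap U fun l => algebraMap (R l) (K l))) ≫ ρ) ≫ Q.π i := by
      rw [Category.assoc, Category.assoc, hρ, e1, spec_iota_pi]
    exact ⟨H.lift _ _ this, H.lift_fst _ _ _, H.lift_snd _ _ _⟩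
  obtain ⟨a, ha, ha'⟩ := ult_exist p hp U R K i₁ ρ h2
  obtain ⟨S, hS, b, hb, hb'⟩ := ult_desc U (tl c U hU i) (x i) g (a ≫ y) (by
    rw [Category.assoc, H.w, reassoc_of% ha, hρ])
  obtain ⟨S', hS', e⟩ := ult_homeq U S g (Spec.map (CommRingCat.ofHom (piMap (fun l => algebraMap (R l) (K l)) _)) ≫ b)
    (Spec.map (CommRingCat.ofHom (ultRes K hS)) ≫ κ) (by
      rw [Category.assoc, Category.assoc, hb', e1]
      refine ev_inj _ _ _ fun l hl => ?_
      rw [spec_ev_pi, spec_ev_res, spec_ev_res, spec_ev_pi]) (by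
      rw [spec_iota_pi, spec_iota_res, hb, reassoc_of% ha', h1])
  obtain ⟨l, hl⟩ := Ultrafilter.nonempty_of_mem S'.2
  refine ⟨l, Spec.map (ev R _ l (hS' hl)) ≫ b, ?_, ?_⟩
  · rw [Category.assoc, hb', spec_ev_res, hx _ _ (hc l)]
  · have := congrArg (fun t => Spec.map (ev K _ l hl) ≫ t) e
    rw [spec_ev_res, spec_ev_res, spec_ev_pi, spec_ev_res, hκ] at this
    exact this

lemma ult_uniqueness {I : Type u} [Preorder I] (Q : ISys I) (c : J → I) (U : Ultrafilter J)
    (hU : ∀ k, {l | c l ≤ k} ∈ U) {i : I} (hc : ∀ l, c l ≤ i)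
    {Y Z : Scheme.{u}} (g : Y ⟶ Q.X i) [LocallyOfFinitePresentation g] [QuasiCompact g] [QuasiSeparated g]
    (y : Z ⟶ Y) (p : Z ⟶ Q.L)
    (H : IsPullback y p g (Q.π i)) (hp : ValuativeCriterion.Uniqueness p)
    (R : J → Type u) [∀ l, CommRing (R l)] [∀ l, IsDomain (R l)] [∀ l, ValuationRing (R l)]
    (K : J → Type u) [∀ l, Field (K l)] [∀ l, Algebra (R l) (K l)] [∀ l, IsFractionRing (R l) (K l)]
    (r : ∀ l, Spec (CommRingCat.of (R l)) ⟶ Q.X (c l))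
    (a b : ∀ l, Spec (CommRingCat.of (R l)) ⟶ Y)
    (ha : ∀ l, a l ≫ g = r l ≫ Q.map (hc l)) (hb : ∀ l, b l ≫ g = r l ≫ Q.map (hc l))
    (w : ∀ l, Spec.map (CommRingCat.ofHom (algebraMap (R l) (K l))) ≫ a l =
      Spec.map (CommRingCat.ofHom (algebraMap (R l) (K l))) ≫ b l) :
    ∃ l, a l = b l := by
  obtain ⟨ρ, x, hρ, hx⟩ := ult_lim Q c U hU r
  haveI := Q.comp i
  haveI := Q.qs i
  haveI : CompactSpace Y := QuasiCompact.compactSpace_of_compactSpace g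
  haveI : QuasiSeparatedSpace Y := quasiSeparatedSpace_of_quasiSeparated g
  obtain ⟨α, hα⟩ := ev_surj (F := R) (tl c U hU i).1 (fun l _ => a l)
  obtain ⟨β, hβ⟩ := ev_surj (F := R) (tl c U hU i).1 (fun l _ => b l)
  have e1 : α ≫ g = x i := ev_inj _ _ _ fun l hl => by
    rw [← Category.assoc, hα, ha, hx _ _ (hc l)]
  have e2 : β ≫ g = x i := ev_inj _ _ _ fun l hl => by
    rw [← Category.assoc, hβ, hb, hx _ _ (hc l)]
  have e3 : Spec.map (CommRingCat.ofHom (piMap (fun l => algebraMap (R l) (K l)) _)) ≫ α =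
      Spec.map (CommRingCat.ofHom (piMap (fun l => algebraMap (R l) (K l)) _)) ≫ β := ev_inj _ _ _ fun l hl => by
    rw [spec_ev_pi, spec_ev_pi, hα, hβ, w]
  obtain ⟨α', h1, h2⟩ : ∃ i₁ : Spec (.of (ultA U R)) ⟶ Z,
      i₁ ≫ y = Spec.map (CommRingCat.ofHom (ultIota U R (tl c U hU i))) ≫ α ∧ i₁ ≫ p = ρ :=
    have : (Spec.map (CommRingCat.ofHom (ultIota U R (tl c U hU i))) ≫ α) ≫ g = ρ ≫ Q.π i := by
      rw [Category.assoc, hρ, e1]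
    ⟨H.lift _ _ this, H.lift_fst _ _ _, H.lift_snd _ _ _⟩
  obtain ⟨β', h1', h2'⟩ : ∃ i₁ : Spec (.of (ultA U R)) ⟶ Z,
      i₁ ≫ y = Spec.map (CommRingCat.ofHom (ultIota U R (tl c U hU i))) ≫ β ∧ i₁ ≫ p = ρ :=
    have : (Spec.map (CommRingCat.ofHom (ultIota U R (tl c U hU i))) ≫ β) ≫ g = ρ ≫ Q.π i := by
      rw [Category.assoc, hρ, e2]
    ⟨H.lift _ _ this, H.lift_fst _ _ _, H.lift_snd _ _ _⟩
  have e4 : α' = β' := ult_unique p hp U R K α' β' (h2.trans h2'.symm) (H.hom_ext (by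
    rw [Category.assoc, Category.assoc, h1, h1', ← spec_iota_pi, ← spec_iota_pi, e3]) (by
    rw [Category.assoc, Category.assoc, h2, h2']))
  obtain ⟨S', hS', e⟩ := ult_homeq U _ g α β (e1.trans e2.symm) (by rw [← h1, ← h1', e4])
  obtain ⟨l, hl⟩ := Ultrafilter.nonempty_of_mem S'.2
  refine ⟨l, ?_⟩
  have := congrArg (fun t => Spec.map (ev R _ l hl) ≫ t) e
  rw [spec_ev_res, spec_ev_res, hα, hβ] at this
  exact this

end

section
variable {I : Type u} [Preorder I] [IsCodirectedOrder I] (Q : ISys I)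

lemma exists_uf (i : I) : ∃ U : Ultrafilter (Set.Iic i), ∀ k, {l : Set.Iic i | l.1 ≤ k} ∈ U := by
  haveI : Nonempty (Set.Iic i) := ⟨⟨i, le_refl i⟩⟩
  refine ⟨Ultrafilter.of Filter.atBot, fun k => Ultrafilter.of_le _ ?_⟩
  obtain ⟨j, h1, h2⟩ := exists_le_le i k
  exact Filter.mem_of_superset (Filter.mem_atBot (⟨j, h1⟩ : Set.Iic i)) fun l hl => le_trans hl h2

lemma uc_desc {i : I} {Y Z : Scheme.{u}} (g : Y ⟶ Q.X i) [LocallyOfFinitePresentation g] [QuasiCompact g]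
    (y : Z ⟶ Y) (p : Z ⟶ Q.L) (H : IsPullback y p g (Q.π i)) [UniversallyClosed p] :
    ∃ (k : I) (h : k ≤ i), ∀ (Y' : Scheme.{u}) (t : Y' ⟶ Y) (g' : Y' ⟶ Q.X k),
      IsPullback t g' g (Q.map h) → UniversallyClosed g' := by
  have hp : ValuativeCriterion.Existence p := by
    have : UniversallyClosed p := inferInstance
    rw [UniversallyClosed.eq_valuativeCriterion] at this
    exact this.1
  by_contra! hcon
  obtain ⟨U, hU⟩ := exists_uf i
  have : ∀ l : Set.Iic i, ∃ (Y' : Scheme.{u}) (t : Y' ⟶ Y) (g' : Y' ⟶ Q.X l.1),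
      IsPullback t g' g (Q.map l.2) ∧ ¬ ValuativeCriterion.Existence g' := by
    intro l
    obtain ⟨Y', t, g', h1, h2⟩ := hcon l.1 l.2
    haveI : QuasiCompact g' := MorphismProperty.of_isPullback (P := @QuasiCompact) h1 inferInstance
    exact ⟨Y', t, g', h1, fun h => h2 (UniversallyClosed.of_valuativeCriterion g' h)⟩
  choose Y' t g' hpb hne using this
  have : ∀ l, ∃ S : ValuativeCommSq (g' l), ¬ S.commSq.HasLift := fun l => not_forall.mp (hne l)
  choose S hS using this
  obtain ⟨l, b, hb1, hb2⟩ := ult_existence Q (fun l : Set.Iic i => l.1) U hU (fun l => l.2) g y p H hp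
    (fun l => (S l).R) (fun l => (S l).K) (fun l => (S l).i₂) (fun l => (S l).i₁ ≫ t l) (fun l => by
      rw [Category.assoc, (hpb l).w, ← Category.assoc, (S l).commSq.w, Category.assoc])
  refine hS l ⟨⟨(hpb l).lift b (S l).i₂ hb1, ?_, (hpb l).lift_snd _ _ _⟩⟩
  refine (hpb l).hom_ext ?_ ?_
  · rw [Category.assoc, (hpb l).lift_fst]; exact hb2
  · rw [Category.assoc, (hpb l).lift_snd]; exact (S l).commSq.w.symm

lemma sep_desc {i : I} {Y Z : Scheme.{u}} (g : Y ⟶ Q.X i) [LocallyOfFinitePresentation g] [QuasiCompact g]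
    [QuasiSeparated g]
    (y : Z ⟶ Y) (p : Z ⟶ Q.L) (H : IsPullback y p g (Q.π i)) [IsSeparated p] :
    ∃ (k : I) (h : k ≤ i), ∀ (Y' : Scheme.{u}) (t : Y' ⟶ Y) (g' : Y' ⟶ Q.X k),
      IsPullback t g' g (Q.map h) → IsSeparated g' := by
  have hp : ValuativeCriterion.Uniqueness p := IsSeparated.valuativeCriterion p
  by_contra! hcon
  obtain ⟨U, hU⟩ := exists_uf i
  have : ∀ l : Set.Iic i, ∃ (Y' : Scheme.{u}) (t : Y' ⟶ Y) (g' : Y' ⟶ Q.X l.1),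
      IsPullback t g' g (Q.map l.2) ∧ ¬ ValuativeCriterion.Uniqueness g' := by
    intro l
    obtain ⟨Y', t, g', h1, h2⟩ := hcon l.1 l.2
    haveI : QuasiSeparated g' := MorphismProperty.of_isPullback (P := @QuasiSeparated) h1 inferInstance
    exact ⟨Y', t, g', h1, fun h => h2 (IsSeparated.of_valuativeCriterion g' h)⟩
  choose Y' t g' hpb hne using this
  have : ∀ l, ∃ S : ValuativeCommSq (g' l), ¬ Subsingleton S.commSq.LiftStruct := fun l => not_forall.mp (hne l)
  choose S hS using this
  have : ∀ l, ∃ a b : (S l).commSq.LiftStruct, a ≠ b := fun l => by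
    by_contra! h
    exact hS l ⟨h⟩
  choose a b hab using this
  obtain ⟨l, hl⟩ := ult_uniqueness Q (fun l : Set.Iic i => l.1) U hU (fun l => l.2) g y p H hp
    (fun l => (S l).R) (fun l => (S l).K) (fun l => (S l).i₂) (fun l => (a l).l ≫ t l) (fun l => (b l).l ≫ t l)
    (fun l => by rw [Category.assoc, (hpb l).w, ← Category.assoc, (a l).fac_right])
    (fun l => by rw [Category.assoc, (hpb l).w, ← Category.assoc, (b l).fac_right])
    (fun l => by rw [← Category.assoc, ← Category.assoc, (a l).fac_left, (b l).fac_left])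
  refine hab l (CommSq.LiftStruct.ext ((hpb l).hom_ext hl ?_))
  rw [(a l).fac_right, (b l).fac_right]

lemma proper_desc {i : I} {Y Z : Scheme.{u}} (g : Y ⟶ Q.X i) [LocallyOfFinitePresentation g] [QuasiCompact g]
    [QuasiSeparated g]
    (y : Z ⟶ Y) (p : Z ⟶ Q.L) (H : IsPullback y p g (Q.π i)) [IsProper p] :
    ∃ (k : I) (h : k ≤ i), ∀ (Y' : Scheme.{u}) (t : Y' ⟶ Y) (g' : Y' ⟶ Q.X k),
      IsPullback t g' g (Q.map h) → IsProper g' := by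
  obtain ⟨k1, h1, e1⟩ := uc_desc Q g y p H
  obtain ⟨k2, h2, e2⟩ := sep_desc Q g y p H
  obtain ⟨k, a1, a2⟩ := exists_le_le k1 k2
  refine ⟨k, a1.trans h1, fun Y' t g' hpb => ?_⟩
  have key : ∀ (k') (h : k ≤ k') (h' : k' ≤ i), ∃ (Y1 : Scheme.{u}) (t1 : Y1 ⟶ Y) (g1 : Y1 ⟶ Q.X k'),
      IsPullback t1 g1 g (Q.map h') ∧ ∃ s, IsPullback s g' g1 (Q.map h) := by
    intro k' h h'
    obtain ⟨Y1, t1, g1, H1⟩ : ∃ (Y1 : Scheme.{u}) (t1 : Y1 ⟶ Y) (g1 : Y1 ⟶ Q.X k'),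
      IsPullback t1 g1 g (Q.map h') := ⟨_, _, _, IsPullback.of_hasPullback _ _⟩
    refine ⟨Y1, t1, g1, H1, H1.lift t (g' ≫ Q.map h) (by rw [hpb.w, Category.assoc, Q.map_comp]), ?_⟩
    refine IsPullback.of_right (t := H1) ?_ (H1.lift_snd _ _ _)
    rw [H1.lift_fst, Q.map_comp]
    exact hpb
  obtain ⟨_, _, g1, H1, s1, H1'⟩ := key k1 a1 h1
  obtain ⟨_, _, g2, H2, s2, H2'⟩ := key k2 a2 h2
  haveI := e1 _ _ _ H1
  haveI := e2 _ _ _ H2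
  haveI : UniversallyClosed g' := MorphismProperty.of_isPullback (P := @UniversallyClosed) H1' inferInstance
  haveI : IsSeparated g' := MorphismProperty.of_isPullback (P := @IsSeparated) H2' inferInstance
  haveI : LocallyOfFinitePresentation g' :=
    MorphismProperty.of_isPullback (P := @LocallyOfFinitePresentation) hpb inferInstance
  exact {}

end

lemma fg_proper (A : Type u) [CommRing A] {Z : Scheme.{u}} (p : Z ⟶ Spec (CommRingCat.of A))
    [IsProper p] [LocallyOfFinitePresentation p] :
    ∃ (i : FGI A) (Y : Scheme.{u}) (g : Y ⟶ Spec (CommRingCat.of i.1)) (y : Z ⟶ Y),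
      IsProper g ∧ LocallyOfFinitePresentation g ∧
      IsPullback y p g (Spec.map (CommRingCat.ofHom i.1.val.toRingHom)) := by
  haveI : CompactSpace Z := QuasiCompact.compactSpace_of_compactSpace p
  haveI : QuasiSeparatedSpace Z := quasiSeparatedSpace_of_quasiSeparated p
  obtain ⟨i, Y, g, y, h1, h2, H⟩ := fg_desc A p
  haveI : IsLocallyNoetherian ((fgR A).sys.X i) := by
    have := fg_noeth A i
    exact inferInstanceAs (IsLocallyNoetherian (Spec (CommRingCat.of i.1)))
  haveI : QuasiSeparated g := quasiSep_of_lft g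
  haveI : IsProper (Y := (fgR A).sys.L) p := ‹IsProper p›
  obtain ⟨k, h, e⟩ := proper_desc (fgR A).sys g y p H
  obtain ⟨Y1, t1, g1, H1⟩ : ∃ (Y1 : Scheme.{u}) (t1 : Y1 ⟶ Y) (g1 : Y1 ⟶ (fgR A).sys.X k),
      IsPullback t1 g1 g ((fgR A).sys.map h) := ⟨_, _, _, IsPullback.of_hasPullback _ _⟩
  obtain ⟨y', _, H'⟩ := ISys.exists_lim _ h g y p H t1 g1 H1
  exact ⟨k, Y1, g1, y', e _ _ _ H1, MorphismProperty.of_isPullback (P := @LocallyOfFinitePresentation) H1 h1, H'⟩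

lemma nil_prime (A : Type u) [CommRing A] [IsDomain A] : (nilradical A).IsPrime := by
  rw [show nilradical A = ⊥ from nilradical_eq_zero A]
  exact Ideal.isPrime_bot

instance nilq_dom (A : Type u) [CommRing A] [IsDomain A] : IsDomain (A ⧸ nilradical A) := by
  have := nil_prime A
  exact Ideal.Quotient.isDomain _

lemma tfm_inj (A : Type u) [CommRing A] [IsDomain A] : Function.Injective (totalFractionMap A).hom := by
  refine (IsFractionRing.injective (A ⧸ nilradical A) (FractionRing (A ⧸ nilradical A))).comp ?_
  intro x y h
  change Ideal.Quotient.mk (nilradical A) x = Ideal.Quotient.mk (nilradical A) y at h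
  rw [Ideal.Quotient.eq, show nilradical A = ⊥ from nilradical_eq_zero A] at h
  exact sub_eq_zero.mp h

lemma frac_map0 {B L : Type u} [CommRing B] [IsDomain B] [Field L] (t : B →+* L) (ht : Function.Injective t) :
    ∃ ψ : FractionRing (B ⧸ nilradical B) →+* L,
      ∀ x, ψ (algebraMap (B ⧸ nilradical B) _ (Ideal.Quotient.mk _ x)) = t x := by
  obtain ⟨g, hg⟩ : ∃ g : B ⧸ nilradical B →+* L, ∀ x, g (Ideal.Quotient.mk _ x) = t x :=
    ⟨Ideal.Quotient.lift _ t (by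
      intro x hx
      rw [show nilradical B = ⊥ from nilradical_eq_zero B] at hx
      rw [show x = 0 from hx, map_zero]), fun x => rfl⟩
  have hg' : Function.Injective g := by
    rw [injective_iff_map_eq_zero]
    intro x hx
    obtain ⟨x, rfl⟩ := Ideal.Quotient.mk_surjective x
    rw [hg, ← map_zero t] at hx
    rw [ht hx, map_zero]
  exact ⟨IsFractionRing.lift hg', fun x => by rw [IsFractionRing.lift_algebraMap, hg]⟩

lemma frac_map {B A : Type u} [CommRing B] [CommRing A] [IsDomain B] [IsDomain A] (φ : B →+* A)
    (hφ : Function.Injective φ) :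
    ∃ ψ : FractionRing (B ⧸ nilradical B) →+* FractionRing (A ⧸ nilradical A),
      totalFractionMap B ≫ CommRingCat.ofHom ψ = CommRingCat.ofHom φ ≫ totalFractionMap A := by
  obtain ⟨ψ, h⟩ := frac_map0 ((totalFractionMap A).hom.comp φ) ((tfm_inj A).comp hφ)
  refine ⟨ψ, ?_⟩
  ext x
  exact h x

lemma field_ff {K L : Type u} [Field K] [Field L] (ψ : K →+* L) :
    (@Surjective ⊓ @Flat ⊓ @QuasiCompact : MorphismProperty Scheme.{u}) (Spec.map (CommRingCat.ofHom ψ)) := by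
  have h : ψ.FaithfullyFlat := by
    letI := ψ.toAlgebra
    exact inferInstanceAs (Module.FaithfullyFlat K L)
  have h' := (flat_and_surjective_SpecMap_iff (CommRingCat.ofHom ψ)).mpr h
  exact ⟨⟨h'.2, h'.1⟩, inferInstance⟩

/-- relation between fibres -/
lemma iso_bc {B A : Type u} [CommRing B] [CommRing A] [IsDomain B] [IsDomain A] (φ : B →+* A)
    (hφ : Function.Injective φ) {Y Z : Scheme.{u}} (g : Y ⟶ Spec (CommRingCat.of B)) (p : Z ⟶ Spec (CommRingCat.of A))
    (y : Z ⟶ Y) (H : IsPullback y p g (Spec.map (CommRingCat.ofHom φ))) :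
    IsIso (pullback.snd p (Spec.map (totalFractionMap A))) ↔
      IsIso (pullback.snd g (Spec.map (totalFractionMap B))) := by
  obtain ⟨ψ, hψ⟩ := frac_map φ hφ
  have hψ' := congrArg Spec.map hψ
  rw [Spec.map_comp, Spec.map_comp] at hψ'
  obtain ⟨V, v, r, HV⟩ : ∃ (V : Scheme.{u}) (v : V ⟶ _) (r : V ⟶ _),
    IsPullback v r (pullback.snd g (Spec.map (totalFractionMap B))) (Spec.map (CommRingCat.ofHom ψ)) :=
      ⟨_, _, _, IsPullback.of_hasPullback _ _⟩
  have P1 := (HV.paste_horiz (IsPullback.of_hasPullback g (Spec.map (totalFractionMap B))))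
  have P2 := ((IsPullback.of_hasPullback p (Spec.map (totalFractionMap A))).paste_horiz H)
  rw [hψ'] at P1
  have e : r = (P1.isoIsPullback _ _ P2).hom ≫ pullback.snd p (Spec.map (totalFractionMap A)) :=
    (IsPullback.isoIsPullback_hom_snd _ _ P1 P2).symm
  have e1 : IsIso (pullback.snd p (Spec.map (totalFractionMap A))) ↔ IsIso r := by
    rw [e]
    exact (isIso_comp_left_iff _ _).symm
  rw [e1]
  constructor
  · intro h
    have hQ := field_ff ψ
    exact MorphismProperty.of_isPullback_of_descendsAlong (P := MorphismProperty.isomorphisms Scheme.{u}) HV.flip hQ h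
  · intro h
    exact MorphismProperty.of_isPullback (P := MorphismProperty.isomorphisms Scheme.{u}) HV h

section
variable {ι : Type u} [Preorder ι] [IsDirected ι (· ≤ ·)] [Nonempty ι]
    (G : ι → Type u) [∀ i, CommRing (G i)]
    (f : ∀ i j, i ≤ j → G i →+* G j)
    [DirectedSystem G fun i j h => ⇑(f i j h)]

/-- the direct limit as a system -/
noncomputable def dlR : RSys ιᵒᵈ where
  R i := CommRingCat.of (G (OrderDual.ofDual i))
  m {i j} h := CommRingCat.ofHom (f (OrderDual.ofDual j) (OrderDual.ofDual i) h)
  m_id i := by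
    ext x
    exact DirectedSystem.map_self (f := fun i j h => ⇑(f i j h)) x
  m_comp {i j k} h h' := by
    ext x
    exact DirectedSystem.map_map (f := fun i j h => ⇑(f i j h)) h' h x
  A := CommRingCat.of (Ring.DirectLimit G fun i j h => ⇑(f i j h))
  ι i := CommRingCat.ofHom (Ring.DirectLimit.of G (fun i j h => ⇑(f i j h)) (OrderDual.ofDual i))
  w h := by
    ext x
    exact Ring.DirectLimit.of_f (f := fun i j h => ⇑(f i j h)) h x
  surj a := Ring.DirectLimit.exists_of a
  inj i x y h := by
    have h' : Ring.DirectLimit.of G (fun i j h => ⇑(f i j h)) (OrderDual.ofDual i) (x - y : G (OrderDual.ofDual i)) = 0 := by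
      rw [map_sub, sub_eq_zero]; exact h
    obtain ⟨k, hk, e⟩ := Ring.DirectLimit.of.zero_exact h'
    refine ⟨OrderDual.toDual k, hk, ?_⟩
    rw [map_sub, sub_eq_zero] at e
    exact e

lemma dl_domain [∀ i, IsDomain (G i)] : IsDomain (Ring.DirectLimit G fun i j h => ⇑(f i j h)) := by
  haveI : Nontrivial (Ring.DirectLimit G fun i j h => ⇑(f i j h)) := by
    obtain ⟨i⟩ := ‹Nonempty ι›
    refine ⟨0, 1, fun h => ?_⟩
    have h' : Ring.DirectLimit.of G (fun i j h => ⇑(f i j h)) i 1 = 0 := by rw [map_one, h]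
    obtain ⟨k, hk, e⟩ := Ring.DirectLimit.of.zero_exact h'
    rw [map_one] at e
    exact one_ne_zero e
  haveI : NoZeroDivisors (Ring.DirectLimit G fun i j h => ⇑(f i j h)) := ⟨by
    intro a b h
    obtain ⟨i, a, rfl⟩ := Ring.DirectLimit.exists_of a
    obtain ⟨j, b, rfl⟩ := Ring.DirectLimit.exists_of b
    obtain ⟨k, hi, hj⟩ := exists_ge_ge i j
    rw [← Ring.DirectLimit.of_f hi, ← Ring.DirectLimit.of_f hj] at h ⊢
    rw [← map_mul] at h
    obtain ⟨l, hl, e⟩ := Ring.DirectLimit.of.zero_exact h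
    rw [map_mul] at e
    rw [← Ring.DirectLimit.of_f hl, ← Ring.DirectLimit.of_f hl (f j k hj b)]
    rcases mul_eq_zero.mp e with h | h
    · left; rw [h, map_zero]
    · right; rw [h, map_zero]⟩
  exact NoZeroDivisors.to_isDomain _

lemma dl_lift (B : Subalgebra ℤ (Ring.DirectLimit G fun i j h => ⇑(f i j h))) (hB : B.FG) :
    ∃ (i : ι) (β : B →+* G i), (Ring.DirectLimit.of G (fun i j h => ⇑(f i j h)) i).comp β = B.val.toRingHom := by
  obtain ⟨i0⟩ := ‹Nonempty ι›
  have hfp0 : (algebraMap ℤ B).FinitePresentation := by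
    have : Algebra.FiniteType ℤ B := B.fg_iff_finiteType.mp hB
    have := Algebra.FinitePresentation.of_finiteType.mp this
    rwa [RingHom.finitePresentation_algebraMap]
  have hfp : ((algebraMap ℤ B).comp (ULift.ringEquiv : ULift.{u} ℤ ≃+* ℤ).toRingHom).FinitePresentation :=
    hfp0.comp (RingHom.FinitePresentation.of_bijective (ULift.ringEquiv : ULift.{u} ℤ ≃+* ℤ).bijective)
  have hz : ∀ {C : Type u} [CommRing C] (a b : ULift.{u} ℤ →+* C), a = b := by
    intro C _ a b
    have := RingHom.ext_int (a.comp (ULift.ringEquiv : ULift.{u} ℤ ≃+* ℤ).symm.toRingHom)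
      (b.comp (ULift.ringEquiv : ULift.{u} ℤ ≃+* ℤ).symm.toRingHom)
    ext x
    exact congrArg (fun t => t (ULift.ringEquiv x)) this
  obtain ⟨z, hzz⟩ : ∃ z, z = (algebraMap ℤ B).comp (ULift.ringEquiv : ULift.{u} ℤ ≃+* ℤ).toRingHom := ⟨_, rfl⟩
  rw [← hzz] at hfp
  haveI : LocallyOfFinitePresentation (Spec.map (CommRingCat.ofHom z)) :=
    (HasRingHomProperty.Spec_iff (P := @LocallyOfFinitePresentation)).mpr hfp
  haveI : Nonempty ιᵒᵈ := ⟨OrderDual.toDual i0⟩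
  have hw : Spec.map (CommRingCat.ofHom B.val.toRingHom) ≫ Spec.map (CommRingCat.ofHom z) =
      Spec.map (CommRingCat.ofHom (Ring.DirectLimit.of G (fun i j h => ⇑(f i j h)) i0)) ≫
        Spec.map (CommRingCat.ofHom ((algebraMap ℤ (G i0)).comp (ULift.ringEquiv : ULift.{u} ℤ ≃+* ℤ).toRingHom)) := by
    rw [← Spec.map_comp, ← Spec.map_comp]
    congr 1
    exact CommRingCat.hom_ext (hz _ _)
  obtain ⟨k, h, b, e, _⟩ := (dlR G f).sys.hom_desc (OrderDual.toDual i0)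
    (Spec.map (CommRingCat.ofHom ((algebraMap ℤ (G i0)).comp (ULift.ringEquiv : ULift.{u} ℤ ≃+* ℤ).toRingHom)))
    (Spec.map (CommRingCat.ofHom z)) (Spec.map (CommRingCat.ofHom B.val.toRingHom)) hw
  obtain ⟨β, rfl⟩ : ∃ β : CommRingCat.of B ⟶ CommRingCat.of (G (OrderDual.ofDual k)), Spec.map β = b :=
    Spec.map_surjective b
  refine ⟨OrderDual.ofDual k, β.hom, ?_⟩
  change Spec.map (CommRingCat.ofHom (Ring.DirectLimit.of G (fun i j h => ⇑(f i j h)) (OrderDual.ofDual k))) ≫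
    Spec.map β = Spec.map (CommRingCat.ofHom B.val.toRingHom) at e
  rw [← Spec.map_comp] at e
  exact congrArg (fun t => t.hom) (Spec.map_injective e)

end

theorem stmt7 {ι : Type u} [Preorder ι] [IsDirected ι (· ≤ ·)] [Nonempty ι]
    (G : ι → Type u) [∀ i, CommRing (G i)] [∀ i, IsDomain (G i)]
    (f : ∀ i j, i ≤ j → G i →+* G j)
    [DirectedSystem G fun i j h => ⇑(f i j h)]
    {X : Scheme.{u}}
    (F : X ⟶ Spec (CommRingCat.of (Ring.DirectLimit G fun i j h => ⇑(f i j h))))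
    (hF : IsMMorphism F) :
    ∃ (i : ι) (Xi : Scheme.{u}) (fi : Xi ⟶ Spec (CommRingCat.of (G i))),
      IsMMorphism fi ∧
      ∃ e : pullback fi (Spec.map (CommRingCat.ofHom
          (Ring.DirectLimit.of G (fun i j h => ⇑(f i j h)) i))) ≅ X,
        e.hom ≫ F = pullback.snd fi (Spec.map (CommRingCat.ofHom
          (Ring.DirectLimit.of G (fun i j h => ⇑(f i j h)) i))) := by
  obtain ⟨h1, h2, h3⟩ := hF
  haveI := dl_domain G f
  obtain ⟨⟨B, hB⟩, Y, g, y, hg1, hg2, H⟩ := fg_proper _ F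
  change Y ⟶ Spec (CommRingCat.of B) at g
  change IsPullback y F g (Spec.map (CommRingCat.ofHom B.val.toRingHom)) at H
  obtain ⟨i, β, hβ⟩ := dl_lift G f B hB
  have hinj : Function.Injective B.val.toRingHom := Subtype.val_injective
  have hβi : Function.Injective β := by
    rw [← hβ, RingHom.coe_comp] at hinj
    exact hinj.of_comp
  haveI : IsDomain B := inferInstance
  obtain ⟨Xi, xi, fi, Hi⟩ : ∃ (Xi : Scheme.{u}) (xi : Xi ⟶ Y) (fi : Xi ⟶ Spec (CommRingCat.of (G i))),
    IsPullback xi fi g (Spec.map (CommRingCat.ofHom β)) := ⟨_, _, _, IsPullback.of_hasPullback _ _⟩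
  refine ⟨i, Xi, fi, ⟨MorphismProperty.of_isPullback (P := @IsProper) Hi hg1,
    MorphismProperty.of_isPullback (P := @LocallyOfFinitePresentation) Hi hg2,
    (iso_bc β hβi g fi xi Hi).mpr ((iso_bc _ hinj g F y H).mp h3)⟩, ?_⟩
  have P := (IsPullback.of_hasPullback fi (Spec.map (CommRingCat.ofHom
          (Ring.DirectLimit.of G (fun i j h => ⇑(f i j h)) i)))).paste_horiz Hi
  rw [← Spec.map_comp, ← CommRingCat.ofHom_comp, hβ] at P
  exact ⟨P.isoIsPullback _ _ H, IsPullback.isoIsPullback_hom_snd _ _ P H⟩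
end
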